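/- Integral representation for a product of two associated Legendre functions of the second kind. Let ν, μ ∈ ℂ with Re(ν−μ) > −1 and such that ν+μ+1 is not a nonpositive integer, and let z₁, z₂ be real numbers with z₁ > 1 and z₂ > 1. Assume that the function z₃ ↦ Q_ν^μ(z₃) · ((z₁²+z₂²+z₃²−1)/(2z₁z₂) − z₃)^{μ−1/2} · (z₃²−1)^{−μ/2} is absolutely integrable on (z₁z₂ + √((z₁²−1)(z₂²−1)), ∞) (note that (z₁²+z₂²+z₃²−1)/(2z₁z₂) − z₃ > 0 on this range). Then Q_ν^μ(z₁) · Q_ν^μ(z₂) = [e^{iπμ} √(π/2) Γ(ν+μ+1)] / [Γ(μ+1/2) Γ(ν−μ+1)] · (z₁z₂)^{μ−1/2} / ((z₁²−1)^{μ/2} (z₂²−1)^{μ/2}) × ∫_{z₁z₂+√((z₁²−1)(z₂²−1))}^∞ Q_ν^μ(z₃) · ((z₁²+z₂²+z₃²−1)/(2z₁z₂) − z₃)^{μ−1/2} · (z₃²−1)^{−μ/2} dz₃. -/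

import Mathlib

open MeasureTheory Set

/-- The regularized Gauss hypergeometric function `₂F̃₁(a,b;c;z)`. -/
noncomputable def hyp2F1reg (a b c z : ℂ) : ℂ :=
  ∑' n : ℕ, (ascPochhammer ℂ n).eval a * (ascPochhammer ℂ n).eval b /
      (Complex.Gamma (c + n) * (n.factorial : ℂ)) * z ^ n

/-- The Jacobi function of the second kind `Q_γ^{(α,β)}(z)` for real `z > 1`. -/
noncomputable def jacobiQ (α β γ : ℂ) (z : ℝ) : ℂ :=
  (2 : ℂ) ^ (α + β + γ) * Complex.Gamma (α + γ + 1) * Complex.Gamma (β + γ + 1) *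
    ((z : ℂ) - 1) ^ (-α) * ((z : ℂ) + 1) ^ (-β - γ - 1) *
    hyp2F1reg (γ + 1) (β + γ + 1) (α + β + 2 * γ + 2) (2 / (1 + (z : ℂ)))

/-- The Jacobi function of the first kind `P_γ^{(α,β)}(z)` for real `z > 1`. -/
noncomputable def jacobiP (α β γ : ℂ) (z : ℝ) : ℂ :=
  Complex.Gamma (α + γ + 1) / Complex.Gamma (γ + 1) * (((z : ℂ) + 1) / 2) ^ γ *
    hyp2F1reg (-γ) (-β - γ) (α + 1) (((z : ℂ) - 1) / ((z : ℂ) + 1))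

/-- The Jacobi function of the first kind on the cut `𝖯_γ^{(α,β)}(x)`, `x ∈ (−1,1)`. -/
noncomputable def jacobiPcut (α β γ : ℂ) (x : ℝ) : ℂ :=
  Complex.Gamma (α + γ + 1) / Complex.Gamma (γ + 1) *
    hyp2F1reg (-γ) (α + β + γ + 1) (α + 1) ((1 - (x : ℂ)) / 2)

/-- The Gegenbauer function of the first kind `C_λ^α(z)` for real `z > 1`. -/
noncomputable def gegenbauerC (lam α : ℂ) (z : ℝ) : ℂ :=
  (Real.sqrt Real.pi : ℂ) * Complex.Gamma (lam + 2 * α) /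
      ((2 : ℂ) ^ (2 * α - 1) * Complex.Gamma α * Complex.Gamma (lam + 1)) *
    (((z : ℂ) + 1) / 2) ^ lam *
    hyp2F1reg (-lam) (1 / 2 - α - lam) (α + 1 / 2) (((z : ℂ) - 1) / ((z : ℂ) + 1))

/-- The Gegenbauer function of the first kind on the cut `𝖢_λ^α(x)`, `x ∈ (−1,1)`. -/
noncomputable def gegenbauerCcut (lam α : ℂ) (x : ℝ) : ℂ :=
  (Real.sqrt Real.pi : ℂ) * Complex.Gamma (lam + 2 * α) /
      ((2 : ℂ) ^ (2 * α - 1) * Complex.Gamma α * Complex.Gamma (lam + 1)) *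
    hyp2F1reg (-lam) (lam + 2 * α) (α + 1 / 2) ((1 - (x : ℂ)) / 2)

/-- The Gegenbauer function of the second kind `D_λ^α(z)` for real `z > 1`. -/
noncomputable def gegenbauerD (lam α : ℂ) (z : ℝ) : ℂ :=
  Complex.exp ((Real.pi : ℂ) * Complex.I * α) * (Complex.Gamma (lam + 2 * α) / Complex.Gamma α) *
    (2 * (z : ℂ)) ^ (-lam - 2 * α) *
    hyp2F1reg (lam / 2 + α) (lam / 2 + α + 1 / 2) (lam + α + 1) (1 / (z : ℂ) ^ 2)

/-- The associated Legendre function of the second kind `Q_ν^μ(z)` for real `z > 1`. -/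
noncomputable def legendreQ (ν μ : ℂ) (z : ℝ) : ℂ :=
  (Real.sqrt Real.pi : ℂ) * Complex.exp ((Real.pi : ℂ) * Complex.I * μ) *
    Complex.Gamma (ν + μ + 1) * ((z : ℂ) ^ 2 - 1) ^ (μ / 2) * (2 : ℂ) ^ (-ν - 1) *
    (z : ℂ) ^ (-ν - μ - 1) *
    hyp2F1reg ((ν + μ + 1) / 2) ((ν + μ + 2) / 2) (ν + 3 / 2) (1 / (z : ℂ) ^ 2)

/-- The Legendre function of the first kind `P_ν(z)` for real `z ≥ 1`. -/
noncomputable def legendreP (ν : ℂ) (z : ℝ) : ℂ :=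
  (((z : ℂ) + 1) / 2) ^ ν * hyp2F1reg (-ν) (-ν) 1 (((z : ℂ) - 1) / ((z : ℂ) + 1))

/-- The associated Legendre function of the first kind of order `−μ`, `P_ν^{−μ}(z)`, `z > 1`. -/
noncomputable def legendrePa (ν μ : ℂ) (z : ℝ) : ℂ :=
  (((z : ℂ) - 1) / ((z : ℂ) + 1)) ^ (μ / 2) * (((z : ℂ) + 1) / 2) ^ ν *
    hyp2F1reg (-ν) (μ - ν) (μ + 1) (((z : ℂ) - 1) / ((z : ℂ) + 1))

/-- The Ferrers function of the first kind of order `−μ`, `𝖯_ν^{−μ}(x)`, `x ∈ (−1,1)`. -/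
noncomputable def ferrersP (ν μ : ℂ) (x : ℝ) : ℂ :=
  ((1 - (x : ℂ)) / (1 + (x : ℂ))) ^ (μ / 2) * hyp2F1reg (-ν) (ν + 1) (1 + μ) ((1 - (x : ℂ)) / 2)

/-- The Ferrers function of the second kind of order `−μ`, `𝖰_ν^{−μ}(x)`, `x ∈ (−1,1)`. -/
noncomputable def ferrersQ (ν μ : ℂ) (x : ℝ) : ℂ :=
  -((Real.pi : ℂ) / (2 * Complex.sin ((Real.pi : ℂ) * μ))) *
    (Complex.cos ((Real.pi : ℂ) * (ν - μ)) *
        (Complex.Gamma (ν - μ + 1) / Complex.Gamma (ν + μ + 1)) *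
        ((1 + (x : ℂ)) / (1 - (x : ℂ))) ^ (-μ / 2) *
        hyp2F1reg (-ν) (ν + 1) (1 - μ) ((1 + (x : ℂ)) / 2) -
      Complex.cos ((Real.pi : ℂ) * ν) * ((1 - (x : ℂ)) / (1 + (x : ℂ))) ^ (-μ / 2) *
        hyp2F1reg (-ν) (ν + 1) (1 + μ) ((1 + (x : ℂ)) / 2))

open MeasureTheory Set

theorem qq_alg {p1 p2 u y v q : ℝ} (hp2 : p2 ≠ 0) (hu : u ≠ 0) (hy : y ≠ 0) (hv : v ≠ 0)
    (hq : q ≠ 0) (hvq : v * q = p2 * u * y) (hne : v - q ≠ 0) (hP : 1 - p1 * p2 * y ^ 2 ≠ 0)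
    (hR : (1 - v) * (1 - p1 * v) * (1 - u / v) * (1 - p2 * (u / v)) =
      (1 - q) * (1 - p1 * q) * (1 - u / q) * (1 - p2 * (u / q))) :
    (1 - y) * (1 - p1 * p2 * y) * (1 - p1 * y) * (1 - p2 * y) * (1 - u / y) *
      (1 - p1 * p2 * y * u) / (1 - p1 * p2 * y ^ 2) ^ 2 =
      (1 - v) * (1 - p1 * v) * (1 - u / v) * (1 - p2 * (u / v)) := by
  set K : ℝ := 1 + (1 + p1) * (1 + p2) * u + p1 * p2 * u ^ 2 with hK
  set B : ℝ := (1 + p1) + p1 * (1 + p2) * u with hB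
  set C : ℝ := (1 + p2) * u + (1 + p1) * p2 * u ^ 2 with hC
  have exR : ∀ w : ℝ, w ≠ 0 → (1 - w) * (1 - p1 * w) * (1 - u / w) * (1 - p2 * (u / w)) =
      K + p1 * w ^ 2 - B * w - C / w + p2 * u ^ 2 / w ^ 2 := by
    intro w hw
    rw [hK, hB, hC]; field_simp; ring
  set m : ℝ := p2 * u * y with hm
  have hm0 : m ≠ 0 := by rw [hm]; positivity
  have hqe : q = m / v := by field_simp; linarith
  set a := v + q with ha
  have hG : a * (p1 - p2 * u ^ 2 / m ^ 2) = B - C / m := by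
    rw [exR v hv, exR q hq] at hR
    have h1 : (v - q) * (a * (p1 - p2 * u ^ 2 / m ^ 2) - (B - C / m)) = 0 := by
      rw [← hvq, ha]
      have : (v - q) * ((v + q) * (p1 - p2 * u ^ 2 / (v * q) ^ 2) - (B - C / (v * q))) =
        (K + p1 * v ^ 2 - B * v - C / v + p2 * u ^ 2 / v ^ 2) -
        (K + p1 * q ^ 2 - B * q - C / q + p2 * u ^ 2 / q ^ 2) := by
        field_simp; ring
      rw [this, hR]; ring
    rcases mul_eq_zero.1 h1 with h | h
    · exact absurd h hne
    · linarith
  have hR2 : K + p1 * v ^ 2 - B * v - C / v + p2 * u ^ 2 / v ^ 2 =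
      K - p1 * m - C * a / m + p2 * u ^ 2 * (a ^ 2 - m) / m ^ 2 := by
    have e1 : p1 * v ^ 2 - B * v - C / v + p2 * u ^ 2 / v ^ 2 -
      (- p1 * m - C * a / m + p2 * u ^ 2 * (a ^ 2 - m) / m ^ 2) =
      v * (a * (p1 - p2 * u ^ 2 / m ^ 2) - (B - C / m)) := by
      rw [← hvq, ha]; field_simp; ring
    rw [hG] at e1
    linarith
  have ha2 : a = y * (C / u - B * p2 * y) / (1 - p1 * p2 * y ^ 2) := by
    rw [eq_div_iff hP]
    rw [hm] at hG
    field_simp at hG ⊢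
    linear_combination (-1) * hG
  rw [exR v hv, hR2, ha2, hm, hK, hB, hC]
  obtain ⟨E, hE⟩ : ∃ E, E = 1 - p1 * p2 * y ^ 2 := ⟨_, rfl⟩
  rw [← hE] at hP ⊢
  field_simp
  rw [hE]
  ring

open MeasureTheory Set Filter Topology

theorem qq_inv (W W' : ℝ → ℝ) (hW : ∀ s, HasDerivAt W (W' s) s) (hpos : ∀ s, 0 ≤ s → 0 < W' s)
    (h0 : W 0 = 0) (htop : Tendsto W atTop atTop) :
    ∃ ρ : ℝ → ℝ, Continuous ρ ∧ (∀ r, 0 ≤ r → 0 ≤ ρ r) ∧ (∀ r, 0 ≤ r → W (ρ r) = r) ∧ ρ 0 = 0 ∧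
      ∀ r, 0 < r → HasDerivAt ρ (W' (ρ r))⁻¹ r := by
  have hcont : Continuous W := continuous_iff_continuousAt.2 fun s => (hW s).continuousAt
  have hmono : StrictMonoOn W (Ici 0) := by
    apply strictMonoOn_of_deriv_pos (convex_Ici 0) hcont.continuousOn
    intro s hs
    rw [interior_Ici] at hs
    rw [(hW s).deriv]; exact hpos s (le_of_lt hs)
  let V : ℝ → ℝ := fun s => if 0 ≤ s then W s else s
  have hWnn : ∀ s, 0 ≤ s → 0 ≤ W s := fun s hs => by
    rw [← h0]; exact hmono.monotoneOn (Set.mem_Ici.2 (le_refl (0:ℝ))) hs hs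
  have hVm : StrictMono V := by
    intro s t hst
    simp only [V]
    split_ifs with h1 h2 h2
    · exact hmono h1 h2 hst
    · linarith
    · have := hWnn t h2; linarith
    · exact hst
  have hVs : Function.Surjective V := by
    intro r
    by_cases hr : 0 ≤ r
    · obtain ⟨b, hb0, hb⟩ := ((htop.eventually_ge_atTop r).and (eventually_ge_atTop 0)).exists
      have : r ∈ Icc (W 0) (W b) := ⟨by rw [h0]; exact hr, hb0⟩
      obtain ⟨s, hs, hs2⟩ := intermediate_value_Icc hb hcont.continuousOn this
      exact ⟨s, by simp only [V]; rw [if_pos hs.1]; exact hs2⟩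
    · exact ⟨r, by simp only [V]; rw [if_neg hr]⟩
  let e := hVm.orderIsoOfSurjective V hVs
  have hVe : ∀ r, V (e.symm r) = r := fun r => e.apply_symm_apply r
  have hnn : ∀ r, 0 ≤ r → 0 ≤ e.symm r := by
    intro r hr
    by_contra hlt
    have := hVe r
    simp only [V] at this
    rw [if_neg hlt] at this
    rw [this] at hlt
    exact hlt hr
  have hWe : ∀ r, 0 ≤ r → W (e.symm r) = r := by
    intro r hr
    have := hVe r
    simp only [V] at this
    rwa [if_pos (hnn r hr)] at this
  refine ⟨e.symm, e.symm.continuous, hnn, hWe, ?_, ?_⟩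
  · apply hmono.injOn (hnn 0 le_rfl) (Set.mem_Ici.2 (le_refl (0:ℝ)))
    rw [hWe 0 le_rfl, h0]
  · intro r hr
    apply HasDerivAt.of_local_left_inverse e.symm.continuous.continuousAt (hW _)
      (hpos _ (hnn r hr.le)).ne'
    filter_upwards [lt_mem_nhds hr] with y hy
    exact hWe y hy.le

noncomputable def qqR (p1 p2 x s : ℝ) : ℝ :=
  (1 - Real.exp (-s)) * (1 - p1 * Real.exp (-s)) * (1 - Real.exp (-(x - s))) *
    (1 - p2 * Real.exp (-(x - s)))

noncomputable def qqS (p1 p2 x s : ℝ) : ℝ :=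
  (1 - Real.exp (-s)) * (1 - p1 * p2 * Real.exp (-s)) * (1 - p1 * Real.exp (-s)) *
    (1 - p2 * Real.exp (-s)) * (1 - Real.exp (-(x - s))) *
    (1 - p1 * p2 * Real.exp (-s) ^ 2 * Real.exp (-(x - s))) /
    (1 - p1 * p2 * Real.exp (-s) ^ 2) ^ 2

theorem qq_slice {p1 p2 x : ℝ} (hp1 : 0 < p1) (hp1' : p1 < 1) (hp2 : 0 < p2) (hp2' : p2 < 1)
    (hx : 0 < x) (g : ℝ → ℝ) (hg : Continuous g) :
    ∫ s in (0:ℝ)..x, g (qqS p1 p2 x s) = ∫ s in (0:ℝ)..x, g (qqR p1 p2 x s) := by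
  set u := Real.exp (-x) with hu
  have hu0 : 0 < u := Real.exp_pos _
  have hu1 : u < 1 := by rw [hu, Real.exp_lt_one_iff]; linarith
  have hP : p1 * p2 < 1 := by nlinarith
  have hP0 : 0 < p1 * p2 := by positivity
  let W : ℝ → ℝ := fun s => (1 - p2 * u * Real.exp (-s)) * (1 - p1 * p2 * u * Real.exp (-s)) *
    (Real.exp s - p2) * (Real.exp s - 1) / p2
  let W' : ℝ → ℝ := fun s => ((((p2 * u * Real.exp (-s)) * (1 - p1 * p2 * u * Real.exp (-s)) +
    (1 - p2 * u * Real.exp (-s)) * (p1 * p2 * u * Real.exp (-s))) * (Real.exp s - p2) +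
    (1 - p2 * u * Real.exp (-s)) * (1 - p1 * p2 * u * Real.exp (-s)) * Real.exp s) *
      (Real.exp s - 1) + (1 - p2 * u * Real.exp (-s)) * (1 - p1 * p2 * u * Real.exp (-s)) *
    (Real.exp s - p2) * Real.exp s) / p2
  have hW : ∀ s, HasDerivAt W (W' s) s := by
    intro s
    have e1 : HasDerivAt (fun s : ℝ => Real.exp (-s)) (-Real.exp (-s)) s := by
      simpa using (hasDerivAt_neg s).exp
    have e2 := Real.hasDerivAt_exp s
    have := (((((e1.const_mul (p2 * u)).const_sub 1).mul
      ((e1.const_mul (p1 * p2 * u)).const_sub 1)).mul (e2.sub_const p2)).mul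
      (e2.sub_const 1)).div_const p2
    refine this.congr_deriv ?_
    simp only [W', Pi.mul_apply]
    ring
  have hW'c : Continuous W' := by fun_prop
  have hpos : ∀ s, 0 ≤ s → 0 < W' s := by
    intro s hs
    have h1 : 1 ≤ Real.exp s := Real.one_le_exp hs
    have h2 : Real.exp (-s) ≤ 1 := by rw [Real.exp_le_one_iff]; linarith
    have h3 := Real.exp_pos (-s)
    have a1 : 0 < 1 - p2 * u * Real.exp (-s) := by
      have : p2 * u * Real.exp (-s) < 1 := by
        calc _ ≤ p2 * u * 1 := by gcongr
          _ < 1 := by nlinarith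
      linarith
    have a2 : 0 < 1 - p1 * p2 * u * Real.exp (-s) := by
      have : p1 * p2 * u * Real.exp (-s) < 1 := by
        calc _ ≤ p1 * p2 * u * 1 := by gcongr
          _ < 1 := by nlinarith
      linarith
    have a3 : 0 < Real.exp s - p2 := by linarith
    have a4 : 0 ≤ Real.exp s - 1 := by linarith
    simp only [W']
    positivity
  have h0 : W 0 = 0 := by simp [W]
  have htop : Tendsto W atTop atTop := by
    have e1 : Tendsto (fun s : ℝ => Real.exp (-s)) atTop (𝓝 0) :=
      Real.tendsto_exp_atBot.comp tendsto_neg_atTop_atBot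
    have e2 := Real.tendsto_exp_atTop
    have a1 : Tendsto (fun s : ℝ => (1 - p2 * u * Real.exp (-s)) *
        (1 - p1 * p2 * u * Real.exp (-s))) atTop (𝓝 1) := by
      simpa using ((e1.const_mul (p2 * u)).const_sub 1).mul
        ((e1.const_mul (p1 * p2 * u)).const_sub 1)
    have a2 : Tendsto (fun s => Real.exp s - p2) atTop atTop := tendsto_atTop_add_const_right _ _ e2
    have a3 : Tendsto (fun s => Real.exp s - 1) atTop atTop := tendsto_atTop_add_const_right _ _ e2
    exact ((a1.pos_mul_atTop one_pos a2).atTop_mul_atTop₀ a3).atTop_div_const hp2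
  obtain ⟨ρ, hρc, hρ0, hρW, hρz, hρd⟩ := qq_inv W W' hW hpos h0 htop
  let R : ℝ → ℝ := qqR p1 p2 x
  have hRd : ∃ R' : ℝ → ℝ, Continuous R' ∧ ∀ s, HasDerivAt R (R' s) s := by
    have hR : ContDiff ℝ 1 R := by
      have : R = fun s => (1 - Real.exp (-s)) * (1 - p1 * Real.exp (-s)) * (1 - Real.exp (-(x - s))) *
    (1 - p2 * Real.exp (-(x - s))) := rfl
      rw [this]; fun_prop
    exact ⟨deriv R, hR.continuous_deriv le_rfl, fun s =>
      (hR.differentiable one_ne_zero s).hasDerivAt⟩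
  obtain ⟨R', hR'c, hRd⟩ := hRd
  have hRc : Continuous R := continuous_iff_continuousAt.2 fun s => (hRd s).continuousAt
  have hR0 : R 0 = 0 := by simp [R, qqR]
  have hRx : R x = 0 := by simp [R, qqR]
  have hlt1 : ∀ s, 0 < s → Real.exp (-s) < 1 := fun s hs => by
    rw [Real.exp_lt_one_iff]; linarith
  have hRpos : ∀ s ∈ Ioo 0 x, 0 < R s := by
    intro s hs
    have h1 := hlt1 s hs.1
    have h2 := hlt1 (x - s) (by linarith [hs.2])
    have h3 := Real.exp_pos (-s)
    have h4 := Real.exp_pos (-(x - s))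
    have a1 : 0 < 1 - Real.exp (-s) := by linarith
    have a2 : 0 < 1 - p1 * Real.exp (-s) := by nlinarith
    have a3 : 0 < 1 - Real.exp (-(x - s)) := by linarith
    have a4 : 0 < 1 - p2 * Real.exp (-(x - s)) := by nlinarith
    simp only [R, qqR]; positivity
  have hRnn : ∀ s ∈ Icc 0 x, 0 ≤ R s := by
    intro s hs
    rcases eq_or_lt_of_le hs.1 with h | h
    · rw [← h, hR0]
    rcases eq_or_lt_of_le hs.2 with h' | h'
    · rw [h', hRx]
    exact (hRpos s ⟨h, h'⟩).le
  let f : ℝ → ℝ := fun s => s + ρ (R s)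
  let f' : ℝ → ℝ := fun s => 1 + (W' (ρ (R s)))⁻¹ * R' s
  have hI : uIcc 0 x = Icc 0 x := uIcc_of_le hx.le
  have hf'c : ContinuousOn f' (uIcc 0 x) := by
    rw [hI]
    have : ContinuousOn (fun s => (W' (ρ (R s)))⁻¹) (Icc 0 x) := by
      apply ContinuousOn.inv₀ (by fun_prop)
      intro s hs
      exact (hpos _ (hρ0 _ (hRnn s hs))).ne'
    exact continuousOn_const.add (this.mul hR'c.continuousOn)
  have hfd : ∀ s ∈ Ioo (min 0 x) (max 0 x), HasDerivWithinAt f (f' s) (Ioi s) s := by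
    intro s hs
    rw [min_eq_left hx.le, max_eq_right hx.le] at hs
    exact ((hasDerivAt_id s).add ((hρd _ (hRpos s hs)).comp s (hRd s))).hasDerivWithinAt
  have hSf : ∀ s ∈ Icc 0 x, qqS p1 p2 x (f s) = R s := by
    intro s hs
    set σ := ρ (R s) with hσ
    have hσ0 : 0 ≤ σ := hρ0 _ (hRnn s hs)
    have hWσ : W σ = R s := hρW _ (hRnn s hs)
    set v := Real.exp (-s) with hv
    set t := Real.exp (-σ) with ht
    have hv0 : 0 < v := Real.exp_pos _
    have ht0 : 0 < t := Real.exp_pos _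
    have ht1 : t ≤ 1 := by rw [ht, Real.exp_le_one_iff]; linarith
    have hv1 : v ≤ 1 := by rw [hv, Real.exp_le_one_iff]; linarith [hs.1]
    have huv : u ≤ v := by rw [hu, hv]; apply Real.exp_le_exp.2; linarith [hs.2]
    have hxs : Real.exp (-(x - s)) = u / v := by
      rw [hu, hv, ← Real.exp_sub]; ring_nf
    have hy : Real.exp (-(s + σ)) = v * t := by
      rw [hv, ht, ← Real.exp_add]; ring_nf
    have hxy : Real.exp (-(x - (s + σ))) = u / (v * t) := by
      rw [← hy, hu, ← Real.exp_sub]; ring_nf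
    have hes : Real.exp σ = 1 / t := by rw [ht, Real.exp_neg]; simp
    have hy1 : v * t ≤ 1 := by nlinarith
    have hy0 : 0 < v * t := by positivity
    have hyP : 1 - p1 * p2 * (v * t) ^ 2 ≠ 0 := by
      have : (v * t) ^ 2 ≤ 1 := by nlinarith
      have : p1 * p2 * (v * t) ^ 2 < 1 := by nlinarith
      linarith
    have hlt : p2 * u * t < v := by
      have : p2 * u * t < u := by nlinarith [mul_pos hu0 ht0, mul_pos hp2 hu0]
      linarith
    have key := qq_alg (p1 := p1) (p2 := p2) (u := u) (y := v * t) (v := v) (q := p2 * u * t)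
      hp2.ne' hu0.ne' hy0.ne' hv0.ne' (by positivity) (by ring) (by linarith) hyP
      (by
        have h1 : R s = (1 - v) * (1 - p1 * v) * (1 - u / v) * (1 - p2 * (u / v)) := by
          simp only [R, qqR]; rw [hxs]
        rw [← h1, ← hWσ]
        simp only [W]
        rw [hes]
        field_simp
        ring)
    have h1 : R s = (1 - v) * (1 - p1 * v) * (1 - u / v) * (1 - p2 * (u / v)) := by
      simp only [R, qqR]; rw [hxs]
    rw [h1, ← key]
    simp only [qqS, f]
    rw [← hσ, hy, hxy]
    congr 2
    field_simp
  have hfx : f x = x := by simp only [f]; rw [hRx, hρz, add_zero]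
  have hf0 : f 0 = 0 := by simp only [f]; rw [hR0, hρz, add_zero]
  have hfc : ContinuousOn f (uIcc 0 x) := by fun_prop
  have hfnn : ∀ s ∈ Icc 0 x, 0 ≤ f s := fun s hs => by
    have := hρ0 _ (hRnn s hs)
    have := hs.1
    simp only [f]; linarith
  have hSc : ContinuousOn (qqS p1 p2 x) (Ici 0) := by
    unfold qqS
    apply ContinuousOn.div (by fun_prop) (by fun_prop)
    intro s hs
    have h1 : Real.exp (-s) ≤ 1 := by rw [Real.exp_le_one_iff]; linarith [mem_Ici.1 hs]
    have h2 := Real.exp_pos (-s)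
    have : Real.exp (-s) ^ 2 ≤ 1 := by nlinarith
    have : p1 * p2 * Real.exp (-s) ^ 2 < 1 := by nlinarith
    apply pow_ne_zero
    linarith
  have hgS : ContinuousOn (fun z => g (qqS p1 p2 x z)) (f '' uIcc 0 x) := by
    apply hg.comp_continuousOn
    apply hSc.mono
    rintro _ ⟨s, hs, rfl⟩
    rw [hI] at hs
    exact hfnn s hs
  have sub1 := intervalIntegral.integral_comp_mul_deriv'' (g := fun z => g (qqS p1 p2 x z))
    hfc hfd hf'c hgS
  rw [hf0, hfx] at sub1
  rw [← sub1]
  let h : ℝ → ℝ := fun r => g r * (W' (ρ r))⁻¹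
  have hh : ContinuousOn h (R '' uIcc 0 x) := by
    apply ContinuousOn.mul hg.continuousOn
    apply ContinuousOn.inv₀ (by fun_prop)
    rintro _ ⟨s, hs, rfl⟩
    rw [hI] at hs
    exact (hpos _ (hρ0 _ (hRnn s hs))).ne'
  have sub2 := intervalIntegral.integral_comp_mul_deriv'' (f := R) (f' := R') (g := h) (a := 0) (b := x)
    hRc.continuousOn (fun s _ => (hRd s).hasDerivWithinAt) hR'c.continuousOn hh
  rw [hR0, hRx, intervalIntegral.integral_same] at sub2
  have hhR : ContinuousOn (fun s => (h ∘ R) s * R' s) (uIcc 0 x) :=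
    (hh.comp hRc.continuousOn (mapsTo_image _ _)).mul hR'c.continuousOn
  calc ∫ s in (0:ℝ)..x, ((fun z => g (qqS p1 p2 x z)) ∘ f) s * f' s
      = ∫ s in (0:ℝ)..x, (g (R s) + (h ∘ R) s * R' s) := by
        apply intervalIntegral.integral_congr
        intro s hs
        rw [hI] at hs
        simp only [Function.comp, hSf s hs, f', h]
        ring
    _ = ∫ s in (0:ℝ)..x, g (R s) := by
        rw [intervalIntegral.integral_add _ hhR.intervalIntegrable, sub2, add_zero]
        exact (hg.comp hRc).intervalIntegrable _ _

open MeasureTheory Set Filter Topology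

theorem qq_shear (T : ℝ → ℝ → ℝ) (hT : Measurable (Function.uncurry T)) (E : Set (ℝ × ℝ))
    (hE : MeasurableSet E) :
    ((volume.restrict (Ioi (0:ℝ))).prod (volume.restrict (Ioi (0:ℝ))))
      ((fun q : ℝ × ℝ => (q.1 + q.2, T (q.1 + q.2) q.1)) ⁻¹' E) =
    ∫⁻ x, (Measure.map (T x) (volume.restrict (Ioo 0 x))) (Prod.mk x ⁻¹' E) := by
  have hm : Measurable (fun q : ℝ × ℝ => (q.1 + q.2, T (q.1 + q.2) q.1)) := by
    apply Measurable.prodMk (by fun_prop)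
    exact hT.comp (f := fun q : ℝ × ℝ => (q.1 + q.2, q.1)) (by fun_prop)
  have hm2 : Measurable (fun q : ℝ × ℝ => (q.2, T q.2 q.1)) := by
    apply Measurable.prodMk (by fun_prop)
    exact hT.comp (f := fun q : ℝ × ℝ => (q.2, q.1)) (by fun_prop)
  have hTx : ∀ x, Measurable (T x) := fun x => hT.comp (f := fun s => (x, s)) (by fun_prop)
  let Ω : Set (ℝ × ℝ) := {q | 0 < q.1 ∧ q.1 < q.2 ∧ (q.2, T q.2 q.1) ∈ E}
  have hΩ : MeasurableSet Ω := by
    have h1 : MeasurableSet {q : ℝ × ℝ | 0 < q.1} := measurableSet_lt measurable_const measurable_fst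
    have h2 : MeasurableSet {q : ℝ × ℝ | q.1 < q.2} := measurableSet_lt measurable_fst measurable_snd
    exact h1.inter (h2.inter (hm2 hE))
  let k : ℝ → ℝ → ENNReal := fun s x => Ω.indicator (fun _ => 1) (s, x)
  have hk : Measurable (Function.uncurry k) := (measurable_const.indicator hΩ)
  have lhs : ((volume.restrict (Ioi (0:ℝ))).prod (volume.restrict (Ioi (0:ℝ))))
      ((fun q : ℝ × ℝ => (q.1 + q.2, T (q.1 + q.2) q.1)) ⁻¹' E) = ∫⁻ s, ∫⁻ x, k s x := by
    rw [Measure.prod_restrict, Measure.restrict_apply (hm hE),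
      Measure.prod_apply ((hm hE).inter (measurableSet_Ioi.prod measurableSet_Ioi))]
    apply lintegral_congr
    intro s
    rw [← lintegral_add_left_eq_self (fun x => k s x) s, ← lintegral_indicator_one]
    · apply lintegral_congr
      intro t
      simp only [k, Ω, indicator, Pi.one_apply]
      congr 1
      simp only [eq_iff_iff, lt_add_iff_pos_right, mem_preimage, mem_inter_iff, mem_prod, mem_Ioi,
        mem_ofPred_eq]
      tauto
    · exact measurable_prodMk_left ((hm hE).inter (measurableSet_Ioi.prod measurableSet_Ioi))
  rw [lhs, lintegral_lintegral_swap hk.aemeasurable]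
  apply lintegral_congr
  intro x
  have hmE : MeasurableSet (Prod.mk x ⁻¹' E) := measurable_prodMk_left hE
  rw [Measure.map_apply (hTx x) hmE, Measure.restrict_apply (hTx x hmE), ← lintegral_indicator_one]
  · apply lintegral_congr
    intro s
    simp only [k, Ω, indicator, Pi.one_apply]
    congr 1
    simp only [eq_iff_iff, mem_preimage, mem_inter_iff, mem_Ioo, mem_ofPred_eq]
    tauto
  · exact (hTx x hmE).inter measurableSet_Ioo

theorem qqR_meas (p1 p2 : ℝ) : Measurable (Function.uncurry (qqR p1 p2)) := by
  unfold qqR Function.uncurry; fun_prop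

theorem qqS_meas (p1 p2 : ℝ) : Measurable (Function.uncurry (qqS p1 p2)) := by
  unfold qqS Function.uncurry; fun_prop

theorem qq_map_slice {p1 p2 x : ℝ} (hp1 : 0 < p1) (hp1' : p1 < 1) (hp2 : 0 < p2) (hp2' : p2 < 1) :
    Measure.map (qqS p1 p2 x) (volume.restrict (Ioo 0 x)) =
    Measure.map (qqR p1 p2 x) (volume.restrict (Ioo 0 x)) := by
  rcases le_or_gt x 0 with hx | hx
  · simp [Ioo_eq_empty (not_lt.2 hx)]
  have mR : Measurable (qqR p1 p2 x) := (qqR_meas p1 p2).comp (f := fun s => (x, s)) (by fun_prop)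
  have mS : Measurable (qqS p1 p2 x) := (qqS_meas p1 p2).comp (f := fun s => (x, s)) (by fun_prop)
  apply MeasureTheory.ext_of_forall_integral_eq_of_IsFiniteMeasure
  intro f
  rw [integral_map mS.aemeasurable f.continuous.aestronglyMeasurable,
    integral_map mR.aemeasurable f.continuous.aestronglyMeasurable]
  have := qq_slice hp1 hp1' hp2 hp2' hx f f.continuous
  rw [intervalIntegral.integral_of_le hx.le, intervalIntegral.integral_of_le hx.le,
    integral_Ioc_eq_integral_Ioo, integral_Ioc_eq_integral_Ioo] at this
  exact this

theorem qq_map {p1 p2 : ℝ} (hp1 : 0 < p1) (hp1' : p1 < 1) (hp2 : 0 < p2) (hp2' : p2 < 1) :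
    Measure.map (fun q : ℝ × ℝ => (q.1 + q.2, qqS p1 p2 (q.1 + q.2) q.1))
      ((volume.restrict (Ioi (0:ℝ))).prod (volume.restrict (Ioi (0:ℝ)))) =
    Measure.map (fun q : ℝ × ℝ => (q.1 + q.2, qqR p1 p2 (q.1 + q.2) q.1))
      ((volume.restrict (Ioi (0:ℝ))).prod (volume.restrict (Ioi (0:ℝ)))) := by
  have hm : ∀ T : ℝ → ℝ → ℝ, Measurable (Function.uncurry T) →
      Measurable (fun q : ℝ × ℝ => (q.1 + q.2, T (q.1 + q.2) q.1)) := fun T hT => by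
    apply Measurable.prodMk (by fun_prop)
    exact hT.comp (f := fun q : ℝ × ℝ => (q.1 + q.2, q.1)) (by fun_prop)
  ext E hE
  rw [Measure.map_apply (hm _ (qqS_meas p1 p2)) hE, Measure.map_apply (hm _ (qqR_meas p1 p2)) hE,
    qq_shear _ (qqS_meas p1 p2) E hE, qq_shear _ (qqR_meas p1 p2) E hE]
  apply lintegral_congr
  intro x
  rw [qq_map_slice hp1 hp1' hp2 hp2']

theorem qq_transfer {p1 p2 : ℝ} (hp1 : 0 < p1) (hp1' : p1 < 1) (hp2 : 0 < p2) (hp2' : p2 < 1)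
    (G : ℝ × ℝ → ℂ) (hG : Measurable G)
    (hi : Integrable (fun q : ℝ × ℝ => G (q.1 + q.2, qqR p1 p2 (q.1 + q.2) q.1))
      ((volume.restrict (Ioi (0:ℝ))).prod (volume.restrict (Ioi (0:ℝ))))) :
    Integrable (fun q : ℝ × ℝ => G (q.1 + q.2, qqS p1 p2 (q.1 + q.2) q.1))
      ((volume.restrict (Ioi (0:ℝ))).prod (volume.restrict (Ioi (0:ℝ)))) ∧
    ∫ q : ℝ × ℝ, G (q.1 + q.2, qqS p1 p2 (q.1 + q.2) q.1)
      ∂((volume.restrict (Ioi (0:ℝ))).prod (volume.restrict (Ioi (0:ℝ)))) =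
    ∫ q : ℝ × ℝ, G (q.1 + q.2, qqR p1 p2 (q.1 + q.2) q.1)
      ∂((volume.restrict (Ioi (0:ℝ))).prod (volume.restrict (Ioi (0:ℝ)))) := by
  have hm : ∀ T : ℝ → ℝ → ℝ, Measurable (Function.uncurry T) →
      Measurable (fun q : ℝ × ℝ => (q.1 + q.2, T (q.1 + q.2) q.1)) := fun T hT => by
    apply Measurable.prodMk (by fun_prop)
    exact hT.comp (f := fun q : ℝ × ℝ => (q.1 + q.2, q.1)) (by fun_prop)
  have mS := hm _ (qqS_meas p1 p2)
  have mR := hm _ (qqR_meas p1 p2)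
  constructor
  · have h1 := (integrable_map_measure hG.aestronglyMeasurable mR.aemeasurable).2 hi
    rw [← qq_map hp1 hp1' hp2 hp2'] at h1
    exact (integrable_map_measure hG.aestronglyMeasurable mS.aemeasurable).1 h1
  · rw [← integral_map (f := G) mS.aemeasurable hG.aestronglyMeasurable,
      ← integral_map (f := G) mR.aemeasurable hG.aestronglyMeasurable, qq_map hp1 hp1' hp2 hp2']

open MeasureTheory Set Filter Topology

noncomputable def hc (a b c : ℂ) (n : ℕ) : ℂ :=
  (ascPochhammer ℂ n).eval a * (ascPochhammer ℂ n).eval b /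
      (Complex.Gamma (c + n) * (n.factorial : ℂ))

theorem hyp_eq (a b c z : ℂ) : hyp2F1reg a b c z = ∑' n, hc a b c n * z ^ n := rfl

theorem hc_rec (a b c : ℂ) (n : ℕ) :
    ((n : ℂ) + 1) * (c + n) * hc a b c (n + 1) = (a + n) * (b + n) * hc a b c n := by
  unfold hc
  have h := Complex.one_div_Gamma_eq_self_mul_one_div_Gamma_add_one (c + n)
  rw [ascPochhammer_succ_eval, ascPochhammer_succ_eval, Nat.factorial_succ]
  push_cast
  simp only [← add_assoc, div_eq_mul_inv, mul_inv, h]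
  have h1 : (n : ℂ) + 1 ≠ 0 := by exact_mod_cast Nat.succ_ne_zero n
  have h2 : (n.factorial : ℂ) ≠ 0 := by exact_mod_cast n.factorial_ne_zero
  field_simp

theorem hc_cont (n : ℕ) : Continuous (fun q : ℂ × ℂ × ℂ => hc q.1 q.2.1 q.2.2 n) := by
  have h := Complex.differentiable_one_div_Gamma.continuous
  have : (fun q : ℂ × ℂ × ℂ => hc q.1 q.2.1 q.2.2 n) = fun q =>
    (ascPochhammer ℂ n).eval q.1 * (ascPochhammer ℂ n).eval q.2.1 *
      (Complex.Gamma (q.2.2 + n))⁻¹ * ((n.factorial : ℂ))⁻¹ := by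
    funext q; unfold hc; rw [div_eq_mul_inv, mul_inv]; ring
  rw [this]
  have h2 : Continuous fun q : ℂ × ℂ × ℂ => (Complex.Gamma (q.2.2 + n))⁻¹ :=
    h.comp (f := fun q : ℂ × ℂ × ℂ => q.2.2 + n) (by fun_prop)
  have h3 : Continuous fun x : ℂ => (ascPochhammer ℂ n).eval x := Polynomial.continuous _
  exact (((h3.comp continuous_fst).mul (h3.comp (continuous_fst.comp continuous_snd))).mul h2).mul
    continuous_const

theorem hc_diff (n : ℕ) {a b c : ℂ → ℂ} (ha : Differentiable ℂ a) (hb : Differentiable ℂ b)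
    (hcc : Differentiable ℂ c) : Differentiable ℂ (fun t => hc (a t) (b t) (c t) n) := by
  have h := Complex.differentiable_one_div_Gamma
  have : (fun t => hc (a t) (b t) (c t) n) = fun t =>
    (ascPochhammer ℂ n).eval (a t) * (ascPochhammer ℂ n).eval (b t) *
      (Complex.Gamma (c t + n))⁻¹ * ((n.factorial : ℂ))⁻¹ := by
    funext q; unfold hc; rw [div_eq_mul_inv, mul_inv]; ring
  rw [this]
  have h2 : Differentiable ℂ fun t => (Complex.Gamma (c t + n))⁻¹ :=
    h.comp (f := fun t => c t + n) (by fun_prop)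
  have h3 : Differentiable ℂ fun x : ℂ => (ascPochhammer ℂ n).eval x := Polynomial.differentiable _
  exact (((h3.comp ha).mul (h3.comp hb)).mul h2).mul_const _

theorem hc_bound (K ρ : ℝ) (hρ : 1 < ρ) : ∃ B : ℝ, 0 ≤ B ∧ ∀ a b c : ℂ, ‖a‖ ≤ K → ‖b‖ ≤ K → ‖c‖ ≤ K →
    ∀ n, ‖hc a b c n‖ ≤ B * ρ ^ n := by
  have hlim : Tendsto (fun n : ℕ => ((n:ℝ) + K) * (n + K) / ((n + 1) * (n - K))) atTop (𝓝 1) := by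
    have e0 : Tendsto (fun n : ℕ => ((n:ℝ))⁻¹) atTop (𝓝 0) := tendsto_inv_atTop_nhds_zero_nat
    have e1 : Tendsto (fun n : ℕ => (1 + K * (n:ℝ)⁻¹) * (1 + K * (n:ℝ)⁻¹) /
      ((1 + 1 * (n:ℝ)⁻¹) * (1 - K * (n:ℝ)⁻¹))) atTop (𝓝 ((1 + K * 0) * (1 + K * 0) /
        ((1 + 1 * 0) * (1 - K * 0)))) := by
      apply Tendsto.div
      · exact ((e0.const_mul K).const_add 1).mul ((e0.const_mul K).const_add 1)
      · exact ((e0.const_mul 1).const_add 1).mul ((e0.const_mul K).const_sub 1)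
      · simp
    simp only [mul_zero, add_zero, sub_zero, mul_one, div_one] at e1
    refine e1.congr' ?_
    filter_upwards [eventually_gt_atTop 0] with n hn
    have hn' : (n:ℝ) ≠ 0 := by positivity
    have a1 : 1 + K * (n:ℝ)⁻¹ = (n + K) / n := by field_simp
    have a2 : 1 + 1 * (n:ℝ)⁻¹ = (n + 1) / n := by field_simp
    have a3 : 1 - K * (n:ℝ)⁻¹ = (n - K) / n := by field_simp
    rw [a1, a2, a3, div_mul_div_comm, div_mul_div_comm, div_div_div_cancel_right₀ (by positivity)]
  obtain ⟨N, hN⟩ := (((hlim.eventually_lt_const hρ).and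
    (tendsto_natCast_atTop_atTop.eventually_gt_atTop K)).and (eventually_ge_atTop 0)).exists_forall_of_atTop
  have hcpt : IsCompact (Metric.closedBall (0:ℂ) K ×ˢ (Metric.closedBall (0:ℂ) K ×ˢ
    Metric.closedBall (0:ℂ) K)) := (isCompact_closedBall _ _).prod
      ((isCompact_closedBall _ _).prod (isCompact_closedBall _ _))
  have hb : ∀ n, ∃ C, ∀ q ∈ (Metric.closedBall (0:ℂ) K ×ˢ (Metric.closedBall (0:ℂ) K ×ˢ
    Metric.closedBall (0:ℂ) K)), ‖hc q.1 q.2.1 q.2.2 n‖ ≤ C := fun n =>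
    hcpt.exists_bound_of_continuousOn (hc_cont n).continuousOn
  choose C hC using hb
  refine ⟨∑ n ∈ Finset.range (N + 1), |C n|, Finset.sum_nonneg fun _ _ => abs_nonneg _, ?_⟩
  intro a b c ha hb hcK n
  set B := ∑ n ∈ Finset.range (N + 1), |C n|
  have hB0 : 0 ≤ B := Finset.sum_nonneg fun _ _ => abs_nonneg _
  have small : ∀ n, n ≤ N → ‖hc a b c n‖ ≤ B * ρ ^ n := by
    intro n hn
    have h1 := hC n (a, b, c) (by simp [ha, hb, hcK])
    have h2 : |C n| ≤ B := Finset.single_le_sum (f := fun n => |C n|) (fun _ _ => abs_nonneg _)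
      (Finset.mem_range.2 (by omega))
    calc ‖hc a b c n‖ ≤ C n := h1
      _ ≤ |C n| := le_abs_self _
      _ ≤ B * 1 := by linarith
      _ ≤ B * ρ ^ n := by gcongr; exact one_le_pow₀ hρ.le
  induction n with
  | zero => exact small 0 (by omega)
  | succ n ih =>
    rcases le_or_gt (n + 1) N with h | h
    · exact small _ h
    obtain ⟨⟨h1, h2⟩, -⟩ := hN n (by omega)
    have hr := congrArg norm (hc_rec a b c n)
    simp only [norm_mul] at hr
    have n1 : ‖(n:ℂ) + 1‖ = n + 1 := by
      have : (n:ℂ) + 1 = ((n + 1 : ℕ) : ℂ) := by push_cast; ring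
      rw [this, Complex.norm_natCast]; push_cast; ring
    have n2 : (n:ℝ) - K ≤ ‖c + n‖ := by
      have := norm_sub_norm_le (n:ℂ) (-c)
      rw [Complex.norm_natCast, norm_neg, sub_neg_eq_add, add_comm (n:ℂ)] at this
      linarith
    have n3 : ‖a + n‖ ≤ n + K := by
      have := norm_add_le a n
      rw [Complex.norm_natCast] at this; linarith
    have n4 : ‖b + n‖ ≤ n + K := by
      have := norm_add_le b n
      rw [Complex.norm_natCast] at this; linarith
    have hnK : 0 < (n:ℝ) - K := by linarith
    have hn1 : 0 < (n:ℝ) + 1 := by positivity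
    have hKn : 0 ≤ (n:ℝ) + K := (norm_nonneg _).trans n3
    have h3 : ((n:ℝ) + 1) * (n - K) * ‖hc a b c (n+1)‖ ≤ ((n:ℝ) + K) * (n + K) * (B * ρ ^ n) := by
      calc ((n:ℝ) + 1) * (n - K) * ‖hc a b c (n+1)‖ ≤ ‖(n:ℂ) + 1‖ * ‖c + n‖ * ‖hc a b c (n+1)‖ := by
            rw [n1]; gcongr
        _ = ‖a + n‖ * ‖b + n‖ * ‖hc a b c n‖ := hr
        _ ≤ _ := by gcongr
    rw [div_lt_iff₀ (by positivity)] at h1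
    have h4 : ((n:ℝ) + 1) * (n - K) * ‖hc a b c (n+1)‖ ≤ ((n:ℝ) + 1) * (n - K) * (B * ρ ^ (n+1)) := by
      calc _ ≤ ((n:ℝ) + K) * (n + K) * (B * ρ ^ n) := h3
        _ ≤ (ρ * (((n:ℝ) + 1) * (n - K))) * (B * ρ ^ n) := by gcongr
        _ = _ := by ring
    exact le_of_mul_le_mul_left h4 (by positivity)

theorem hc_dom (K r : ℝ) (hr0 : 0 ≤ r) (hr : r < 1) : ∃ u : ℕ → ℝ, Summable u ∧ (∀ n, 0 ≤ u n) ∧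
    ∀ a b c z : ℂ, ‖a‖ ≤ K → ‖b‖ ≤ K → ‖c‖ ≤ K → ‖z‖ ≤ r → ∀ n, ‖hc a b c n * z ^ n‖ ≤ u n := by
  obtain ⟨ρ, h1, h2⟩ : ∃ ρ : ℝ, 1 < ρ ∧ ρ * r < 1 := by
    refine ⟨2 / (1 + r), ?_, ?_⟩
    · rw [lt_div_iff₀ (by linarith)]; linarith
    · rw [div_mul_eq_mul_div, div_lt_one (by linarith)]; linarith
  obtain ⟨B, hB, hb⟩ := hc_bound K ρ h1
  refine ⟨fun n => B * (ρ * r) ^ n, (summable_geometric_of_lt_one (by positivity) h2).mul_left B,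
    fun n => by positivity, ?_⟩
  intro a b c z ha hb' hc' hz n
  show _ ≤ B * (ρ * r) ^ n
  rw [norm_mul, norm_pow, mul_pow, ← mul_assoc]
  gcongr
  exact hb a b c ha hb' hc' n

theorem hc_summable (a b c z : ℂ) (hz : ‖z‖ < 1) : Summable (fun n => hc a b c n * z ^ n) := by
  obtain ⟨u, hu, -, h⟩ := hc_dom (max ‖a‖ (max ‖b‖ ‖c‖)) ‖z‖ (norm_nonneg _) hz
  exact Summable.of_norm_bounded hu (h a b c z (by simp) (by simp) (by simp) le_rfl)

theorem hc_summable_norm (a b c z : ℂ) (hz : ‖z‖ < 1) : Summable (fun n => ‖hc a b c n * z ^ n‖) := by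
  obtain ⟨u, hu, -, h⟩ := hc_dom (max ‖a‖ (max ‖b‖ ‖c‖)) ‖z‖ (norm_nonneg _) hz
  exact Summable.of_nonneg_of_le (fun _ => norm_nonneg _) (h a b c z (by simp) (by simp) (by simp) le_rfl) hu

theorem hyp_bound (K r : ℝ) (hr0 : 0 ≤ r) (hr : r < 1) : ∃ M : ℝ, 0 ≤ M ∧
    ∀ a b c z : ℂ, ‖a‖ ≤ K → ‖b‖ ≤ K → ‖c‖ ≤ K → ‖z‖ ≤ r → ‖hyp2F1reg a b c z‖ ≤ M := by
  obtain ⟨u, hu, hu0, h⟩ := hc_dom K r hr0 hr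
  refine ⟨∑' n, u n, tsum_nonneg hu0, ?_⟩
  intro a b c z ha hb hc' hz
  exact tsum_of_norm_bounded hu.hasSum (h a b c z ha hb hc' hz)

theorem hyp_diff_z (a b c : ℂ) : DifferentiableOn ℂ (hyp2F1reg a b c) (Metric.ball 0 1) := by
  intro z hz
  rw [mem_ball_zero_iff] at hz
  obtain ⟨r, hzr, hr⟩ := exists_between hz
  obtain ⟨u, hu, hu0, h⟩ := hc_dom (max ‖a‖ (max ‖b‖ ‖c‖)) r ((norm_nonneg _).trans hzr.le) hr
  have : DifferentiableOn ℂ (hyp2F1reg a b c) (Metric.ball 0 r) := by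
    apply Complex.differentiableOn_tsum_of_summable_norm hu
    · intro n; fun_prop
    · exact Metric.isOpen_ball
    · intro n w hw
      rw [mem_ball_zero_iff] at hw
      exact h a b c w (by simp) (by simp) (by simp) hw.le n
  exact (this.differentiableAt (Metric.isOpen_ball.mem_nhds
    (mem_ball_zero_iff.2 hzr))).differentiableWithinAt

theorem hyp_diff_param {a b c : ℂ → ℂ} (ha : Differentiable ℂ a) (hb : Differentiable ℂ b)
    (hcc : Differentiable ℂ c) (z : ℂ) (hz : ‖z‖ < 1) :
    Differentiable ℂ (fun t => hyp2F1reg (a t) (b t) (c t) z) := by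
  intro t
  obtain ⟨K, hK⟩ : ∃ K : ℝ, ∀ s ∈ Metric.closedBall t 1, ‖a s‖ ≤ K ∧ ‖b s‖ ≤ K ∧ ‖c s‖ ≤ K := by
    obtain ⟨A, hA⟩ := (isCompact_closedBall t 1).exists_bound_of_continuousOn ha.continuous.continuousOn
    obtain ⟨B, hB⟩ := (isCompact_closedBall t 1).exists_bound_of_continuousOn hb.continuous.continuousOn
    obtain ⟨C, hC⟩ := (isCompact_closedBall t 1).exists_bound_of_continuousOn hcc.continuous.continuousOn
    refine ⟨max A (max B C), fun s hs => ⟨(hA s hs).trans (by simp), (hB s hs).trans (by simp),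
      (hC s hs).trans (by simp)⟩⟩
  obtain ⟨u, hu, hu0, h⟩ := hc_dom K ‖z‖ (norm_nonneg _) hz
  have : DifferentiableOn ℂ (fun t => hyp2F1reg (a t) (b t) (c t) z) (Metric.ball t 1) := by
    apply Complex.differentiableOn_tsum_of_summable_norm hu
    · intro n; exact ((hc_diff n ha hb hcc).mul_const _).differentiableOn
    · exact Metric.isOpen_ball
    · intro n w hw
      obtain ⟨h1, h2, h3⟩ := hK w (Metric.ball_subset_closedBall hw)
      exact h _ _ _ z h1 h2 h3 le_rfl n
  exact this.differentiableAt (Metric.ball_mem_nhds _ one_pos)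

theorem hyp_lip (K r : ℝ) (hr0 : 0 ≤ r) (hr : r < 1) : ∃ L : ℝ, 0 ≤ L ∧
    ∀ a b c z w : ℂ, ‖a‖ ≤ K → ‖b‖ ≤ K → ‖c‖ ≤ K → ‖z‖ ≤ r → ‖w‖ ≤ r →
    ‖hyp2F1reg a b c z - hyp2F1reg a b c w‖ ≤ L * ‖z - w‖ := by
  obtain ⟨r', h1, h2⟩ := exists_between hr
  obtain ⟨M, hM0, hM⟩ := hyp_bound K r' (by linarith) h2
  refine ⟨M / (r' - r), div_nonneg hM0 (by linarith), ?_⟩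
  intro a b c z w ha hb hc' hz hw
  have hd : ∀ x ∈ Metric.closedBall (0:ℂ) r, DifferentiableAt ℂ (hyp2F1reg a b c) x := by
    intro x hx
    apply (hyp_diff_z a b c).differentiableAt (Metric.isOpen_ball.mem_nhds _)
    rw [mem_closedBall_zero_iff] at hx
    rw [mem_ball_zero_iff]; linarith
  apply (convex_closedBall (0:ℂ) r).norm_image_sub_le_of_norm_deriv_le hd (C := M / (r' - r))
  · intro x hx
    rw [mem_closedBall_zero_iff] at hx
    have hsub : ∀ y, dist y x ≤ r' - r → ‖y‖ ≤ r' := by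
      intro y hy
      have := norm_le_norm_add_norm_sub' y x
      rw [dist_eq_norm] at hy
      linarith
    apply Complex.norm_deriv_le_of_forall_mem_sphere_norm_le (by linarith)
    · apply DifferentiableOn.diffContOnCl
      rw [closure_ball _ (by linarith)]
      apply (hyp_diff_z a b c).mono
      intro y hy
      rw [mem_ball_zero_iff]
      linarith [hsub y hy]
    · intro y hy
      exact hM a b c y ha hb hc' (hsub y (le_of_eq hy))
  · simpa using hw
  · simpa using hz

open MeasureTheory Set Filter Topology

theorem hs_congr {f g : ℕ → ℂ} {x y : ℂ} (h : HasSum f x) (h1 : ∀ n, g n = f n) (h2 : y = x) :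
    HasSum g y := by
  rw [h2, funext h1]; exact h

theorem hc_succ (a b c : ℂ) (n : ℕ) :
    ((n : ℂ) + 1) * hc a b c (n + 1) = a * b * hc (a + 1) (b + 1) (c + 1) n := by
  unfold hc
  rw [ascPochhammer_succ_left]
  simp only [Polynomial.eval_mul, Polynomial.eval_X, Polynomial.eval_comp, Polynomial.eval_add,
    Polynomial.eval_one, Nat.factorial_succ]
  push_cast
  have h1 : (n : ℂ) + 1 ≠ 0 := by exact_mod_cast Nat.succ_ne_zero n
  have h2 : (n.factorial : ℂ) ≠ 0 := by exact_mod_cast n.factorial_ne_zero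
  rw [show c + 1 + (n:ℂ) = c + (n + 1) by ring]
  simp only [div_eq_mul_inv, mul_inv]
  field_simp

theorem hyp_deriv (a b c z : ℂ) (hz : ‖z‖ < 1) :
    HasDerivAt (hyp2F1reg a b c) (a * b * hyp2F1reg (a + 1) (b + 1) (c + 1) z) z := by
  obtain ⟨r, hzr, hr⟩ := exists_between hz
  obtain ⟨u, hu, hu0, h⟩ := hc_dom (max ‖a‖ (max ‖b‖ ‖c‖)) r ((norm_nonneg _).trans hzr.le) hr
  have key := Complex.hasSum_deriv_of_summable_norm (F := fun n z => hc a b c n * z ^ n)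
    (U := Metric.ball 0 r) hu (fun n => by fun_prop) Metric.isOpen_ball
    (fun n w hw => by
      rw [mem_ball_zero_iff] at hw
      exact h a b c w (by simp) (by simp) (by simp) hw.le n) (mem_ball_zero_iff.2 hzr)
  have hd : DifferentiableAt ℂ (hyp2F1reg a b c) z := (hyp_diff_z a b c).differentiableAt
    (Metric.isOpen_ball.mem_nhds (mem_ball_zero_iff.2 hz))
  have e : deriv (hyp2F1reg a b c) z = a * b * hyp2F1reg (a + 1) (b + 1) (c + 1) z := by
    have k2 := (hasSum_nat_add_iff' 1).2 key
    have k3 : HasSum (fun n => a * b * (hc (a+1) (b+1) (c+1) n * z ^ n))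
        (a * b * hyp2F1reg (a + 1) (b + 1) (c + 1) z) :=
      (hc_summable (a+1) (b+1) (c+1) z hz).hasSum.mul_left _
    refine HasSum.unique ?_ k3
    refine hs_congr k2 (fun n => ?_) ?_
    · symm
      rw [deriv_const_mul_field, deriv_pow_field, ← mul_assoc, ← mul_assoc (a * b), ← hc_succ]
      push_cast
      ring
    · simp; rfl
  rw [← e]; exact hd.hasDerivAt

theorem hyp_sum1 (a b c z : ℂ) (hz : ‖z‖ < 1) :
    HasSum (fun n : ℕ => (n : ℂ) * (hc a b c n * z ^ n))
      (z * (a * b * hyp2F1reg (a + 1) (b + 1) (c + 1) z)) := by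
  rw [← hasSum_nat_add_iff' 1]
  have k3 : HasSum (fun n => z * (a * b * (hc (a+1) (b+1) (c+1) n * z ^ n)))
        (z * (a * b * hyp2F1reg (a + 1) (b + 1) (c + 1) z)) :=
      ((hc_summable (a+1) (b+1) (c+1) z hz).hasSum.mul_left _).mul_left _
  refine hs_congr k3 (fun n => ?_) ?_
  · rw [← mul_assoc (a * b), ← hc_succ]; push_cast; ring
  · simp

theorem hyp_sum2 (a b c z : ℂ) (hz : ‖z‖ < 1) :
    HasSum (fun n : ℕ => (n : ℂ) ^ 2 * (hc a b c n * z ^ n))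
      (z * (a * b * (z * ((a + 1) * (b + 1) * hyp2F1reg (a + 2) (b + 2) (c + 2) z) +
        hyp2F1reg (a + 1) (b + 1) (c + 1) z))) := by
  rw [← hasSum_nat_add_iff' 1]
  have k1 := hyp_sum1 (a+1) (b+1) (c+1) z hz
  rw [show a + 1 + 1 = a + 2 by ring, show b + 1 + 1 = b + 2 by ring,
    show c + 1 + 1 = c + 2 by ring] at k1
  have k3 := ((k1.add (hc_summable (a+1) (b+1) (c+1) z hz).hasSum).mul_left (a * b)).mul_left z
  refine hs_congr k3 (fun n => ?_) ?_
  · have := hc_succ a b c n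
    push_cast
    linear_combination (((n:ℂ) + 1) * z ^ (n+1)) * this
  · rw [hyp_eq (a + 1)]; simp

theorem hyp_ode (a b c z : ℂ) (hz : ‖z‖ < 1) (hz0 : z ≠ 0) :
    z * (1 - z) * (a * b * ((a + 1) * (b + 1) * hyp2F1reg (a + 2) (b + 2) (c + 2) z)) +
      (c - (a + b + 1) * z) * (a * b * hyp2F1reg (a + 1) (b + 1) (c + 1) z) -
      a * b * hyp2F1reg a b c z = 0 := by
  have s0 : HasSum (fun n : ℕ => hc a b c n * z ^ n) (hyp2F1reg a b c z) :=
    (hc_summable a b c z hz).hasSum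
  have s1 := hyp_sum1 a b c z hz
  have s2 := hyp_sum2 a b c z hz
  have l := s2.add (s1.mul_left (c - 1))
  have r := ((s2.add (s1.mul_left (a + b))).add (s0.mul_left (a * b))).mul_left z
  have l' := (hasSum_nat_add_iff' 1).2 l
  have e := HasSum.unique l' (by
    refine hs_congr r (fun n => ?_) rfl
    have := hc_rec a b c n
    push_cast
    linear_combination (z ^ (n+1)) * this)
  simp at e
  apply mul_left_cancel₀ hz0
  linear_combination e

theorem hyp_zero_of_double (a b c : ℂ) (P : ℝ) (hP0 : 0 < P) (hP1 : P < 1)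
    (h0 : hyp2F1reg a b c P = 0) (h1 : a * b * hyp2F1reg (a + 1) (b + 1) (c + 1) P = 0) :
    ∀ z : ℂ, ‖z‖ < 1 → hyp2F1reg a b c z = 0 := by
  obtain ⟨q, hPq, hq⟩ := exists_between hP1
  let f : ℝ → ℂ := fun x => hyp2F1reg a b c x
  let f1 : ℝ → ℂ := fun x => a * b * hyp2F1reg (a+1) (b+1) (c+1) x
  let f2 : ℝ → ℂ := fun x => a * b * ((a + 1) * (b + 1) * hyp2F1reg (a+2) (b+2) (c+2) x)
  have hn : ∀ x : ℝ, x ∈ Icc P q → ‖(x:ℂ)‖ < 1 := fun x hx => by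
    rw [Complex.norm_real, Real.norm_eq_abs, abs_of_pos (by linarith [hx.1])]; linarith [hx.2]
  have d0 : ∀ x ∈ Icc P q, HasDerivAt f (f1 x) x := fun x hx =>
    (hyp_deriv a b c x (hn x hx)).comp_ofReal
  have d1 : ∀ x ∈ Icc P q, HasDerivAt f1 (f2 x) x := fun x hx => by
    have := ((hyp_deriv (a+1) (b+1) (c+1) x (hn x hx)).comp_ofReal).const_mul (a * b)
    rw [show a + 1 + 1 = a + 2 by ring, show b + 1 + 1 = b + 2 by ring,
      show c + 1 + 1 = c + 2 by ring] at this
    exact this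
  let Y : ℝ → ℂ × ℂ := fun x => (f x, f1 x)
  have dY : ∀ x ∈ Icc P q, HasDerivAt Y (f1 x, f2 x) x := fun x hx => (d0 x hx).prodMk (d1 x hx)
  let K : ℝ := 1 + (‖c‖ + ‖a + b + 1‖ + ‖a * b‖) / (P * (1 - q))
  have hden : 0 < P * (1 - q) := mul_pos hP0 (by linarith)
  have hY := eq_zero_of_abs_deriv_le_mul_abs_self_of_eq_zero_right (f := Y)
    (f' := fun x => (f1 x, f2 x)) (K := K) (a := P) (b := q)
    (fun x hx => (dY x hx).continuousAt.continuousWithinAt)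
    (fun x hx => (dY x (Ico_subset_Icc_self hx)).hasDerivWithinAt)
    (by simp only [Y, f, f1, h0, h1]; rfl)
    (by
      intro x hx
      have hx' := Ico_subset_Icc_self hx
      have b0 : ‖f x‖ ≤ ‖Y x‖ := norm_fst_le (Y x)
      have b1 : ‖f1 x‖ ≤ ‖Y x‖ := norm_snd_le (Y x)
      have hY0 := norm_nonneg (Y x)
      have hfrac : 0 ≤ (‖c‖ + ‖a + b + 1‖ + ‖a * b‖) / (P * (1 - q)) := by positivity
      have ho := hyp_ode a b c x (hn x hx') (by exact_mod_cast (by linarith [hx.1] : x ≠ 0))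
      have e2 : ((x:ℂ) * (1 - x)) * f2 x = a * b * f x - (c - (a + b + 1) * x) * f1 x := by
        simp only [f, f1, f2]; linear_combination ho
      have hx0 : 0 < x := by linarith [hx.1]
      have hxn : ‖(x:ℂ)‖ ≤ 1 := (hn x hx').le
      have hxx : ‖(x:ℂ) * (1 - x)‖ = x * (1 - x) := by
        have : (x:ℂ) * (1 - x) = ((x * (1 - x) : ℝ) : ℂ) := by push_cast; ring
        rw [this, Complex.norm_real, Real.norm_eq_abs, abs_of_pos (mul_pos hx0 (by linarith [hx.2]))]
      have hlow : P * (1 - q) ≤ x * (1 - x) := by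
        apply mul_le_mul hx.1 (by linarith [hx.2]) (by linarith) hx0.le
      have b2 : ‖f2 x‖ ≤ (‖c‖ + ‖a + b + 1‖ + ‖a * b‖) / (P * (1 - q)) * ‖Y x‖ := by
        rw [div_mul_eq_mul_div, le_div_iff₀ hden]
        calc ‖f2 x‖ * (P * (1 - q)) ≤ ‖f2 x‖ * (x * (1 - x)) := by gcongr
          _ = ‖(x:ℂ) * (1 - x) * f2 x‖ := by rw [norm_mul (_ * _) (f2 x), hxx]; ring
          _ = ‖a * b * f x - (c - (a + b + 1) * x) * f1 x‖ := by rw [e2]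
          _ ≤ ‖a * b‖ * ‖f x‖ + ‖c - (a + b + 1) * x‖ * ‖f1 x‖ := by
              refine (norm_sub_le _ _).trans ?_
              rw [norm_mul, norm_mul (c - _)]
          _ ≤ ‖a * b‖ * ‖Y x‖ + (‖c‖ + ‖a + b + 1‖ * 1) * ‖Y x‖ := by
              gcongr
              refine (norm_sub_le _ _).trans ?_
              rw [norm_mul (a + b + 1)]
              gcongr
          _ = _ := by ring
      show ‖(f1 x, f2 x)‖ ≤ K * ‖Y x‖
      rw [Prod.norm_def]
      apply max_le
      · simp only [K]; nlinarith
      · simp only [K]; nlinarith)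
  have hfz : ∀ x ∈ Icc P q, f x = 0 := fun x hx => congrArg Prod.fst (hY x hx)
  have han : AnalyticOnNhd ℂ (hyp2F1reg a b c) (Metric.ball 0 1) :=
    (hyp_diff_z a b c).analyticOnNhd Metric.isOpen_ball
  have hPm : (P:ℂ) ∈ Metric.ball (0:ℂ) 1 := mem_ball_zero_iff.2 (hn P ⟨le_rfl, hPq.le⟩)
  have hfreq : ∃ᶠ z in 𝓝[≠] (P:ℂ), hyp2F1reg a b c z = 0 := by
    have ht : Tendsto (fun x : ℝ => (x:ℂ)) (𝓝[>] P) (𝓝[≠] (P:ℂ)) := by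
      apply tendsto_nhdsWithin_iff.2 ⟨?_, ?_⟩
      · exact (Complex.continuous_ofReal.tendsto P).mono_left nhdsWithin_le_nhds
      · filter_upwards [self_mem_nhdsWithin] with x hx
        simp only [mem_compl_iff, mem_singleton_iff]
        exact_mod_cast (ne_of_gt hx)
    apply ht.frequently
    apply Eventually.frequently
    filter_upwards [Ioc_mem_nhdsGT hPq] with x hx
    exact hfz x ⟨hx.1.le, hx.2⟩
  intro z hz
  exact han.eqOn_zero_of_preconnected_of_frequently_eq_zero
    (convex_ball _ _).isPreconnected hPm hfreq (mem_ball_zero_iff.2 hz)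

open MeasureTheory Set Filter Topology

theorem binom_hasSum (s x : ℂ) (hx : ‖x‖ < 1) :
    HasSum (fun n : ℕ => (ascPochhammer ℂ n).eval s / (n.factorial : ℂ) * x ^ n) (1 / (1 - x) ^ s) := by
  have h := (Complex.one_div_one_sub_cpow_hasFPowerSeriesOnBall_zero s).hasSum_sub (y := x)
    (by rw [← ENNReal.ofReal_one, Metric.eball_ofReal]; simpa using hx)
  refine hs_congr h (fun n => ?_) rfl
  rw [sub_zero, FormalMultilinearSeries.ofScalars_apply_eq, smul_eq_mul, Ring.choose]
  rw [show s + n - 1 - n + 1 = s by ring]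
  have h2 := Ring.factorial_nsmul_multichoose_eq_ascPochhammer s n
  rw [Polynomial.ascPochhammer_smeval_eq_eval, nsmul_eq_mul] at h2
  rw [← h2]
  have : (n.factorial : ℂ) ≠ 0 := by exact_mod_cast n.factorial_ne_zero
  field_simp

theorem hs_congrR {f g : ℕ → ℝ} {x : ℝ} (h : HasSum f x) (e : ∀ n, g n = f n) : HasSum g x := by
  rwa [show g = f from funext e]

theorem rbinom_hasSum (s x : ℝ) (hx : |x| < 1) :
    HasSum (fun n : ℕ => (ascPochhammer ℝ n).eval s / (n.factorial : ℝ) * x ^ n) (1 / (1 - x) ^ s) := by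
  have h := (Real.one_div_one_sub_rpow_hasFPowerSeriesOnBall_zero s).hasSum_sub (y := x)
    (by rw [← ENNReal.ofReal_one, Metric.eball_ofReal]; simpa using hx)
  refine hs_congrR h (fun n => ?_)
  rw [sub_zero, FormalMultilinearSeries.ofScalars_apply_eq, smul_eq_mul, Ring.choose]
  rw [show s + n - 1 - n + 1 = s by ring]
  have h2 := Ring.factorial_nsmul_multichoose_eq_ascPochhammer s n
  rw [Polynomial.ascPochhammer_smeval_eq_eval, nsmul_eq_mul] at h2
  rw [← h2]
  have : (n.factorial : ℝ) ≠ 0 := by exact_mod_cast n.factorial_ne_zero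
  field_simp

theorem asc_bound (s : ℂ) (t : ℝ) (h : ‖s‖ ≤ t) (m : ℕ) :
    ‖(ascPochhammer ℂ m).eval s‖ ≤ (ascPochhammer ℝ m).eval t := by
  have ht : 0 ≤ t := (norm_nonneg _).trans h
  induction m with
  | zero => simp
  | succ m ih =>
    rw [ascPochhammer_succ_eval, ascPochhammer_succ_eval, norm_mul]
    have : ‖s + m‖ ≤ t + m := by
      have := norm_add_le s m
      rw [Complex.norm_natCast] at this; linarith
    gcongr
    exact (norm_nonneg _).trans ih

theorem asc_add (a : ℂ) (n m : ℕ) : (ascPochhammer ℂ (n + m)).eval a =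
    (ascPochhammer ℂ n).eval a * (ascPochhammer ℂ m).eval (a + n) := by
  rw [← ascPochhammer_mul]; simp

theorem asc_double (a : ℂ) (n : ℕ) : (ascPochhammer ℂ n).eval (a / 2) *
    (ascPochhammer ℂ n).eval ((a + 1) / 2) * 4 ^ n = (ascPochhammer ℂ (2 * n)).eval a := by
  induction n with
  | zero => simp
  | succ n ih =>
    rw [show 2 * (n + 1) = 2 * n + 1 + 1 by ring, ascPochhammer_succ_eval, ascPochhammer_succ_eval,
      ascPochhammer_succ_eval, ascPochhammer_succ_eval, ← ih]
    push_cast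
    ring

theorem vander (N : ℕ) : ∀ x c : ℂ, ∑ ij ∈ Finset.HasAntidiagonal.antidiagonal N, (N.choose ij.1 : ℂ) *
    ((-1) ^ ij.2 * (ascPochhammer ℂ ij.1).eval x * (Complex.Gamma (c + ij.1))⁻¹) =
    (ascPochhammer ℂ N).eval (x - c - N + 1) * (Complex.Gamma (c + N))⁻¹ := by
  induction N with
  | zero => intro x c; simp
  | succ N ih =>
    intro x c
    rw [Finset.sum_antidiagonal_choose_succ_mul
      (fun i j => (-1) ^ j * (ascPochhammer ℂ i).eval x * (Complex.Gamma (c + i))⁻¹)]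
    have e1 : ∑ ij ∈ Finset.HasAntidiagonal.antidiagonal N, (N.choose ij.1 : ℂ) *
      ((-1) ^ (ij.2 + 1) * (ascPochhammer ℂ ij.1).eval x * (Complex.Gamma (c + ij.1))⁻¹) =
      - ((ascPochhammer ℂ N).eval (x - c - N + 1) * (Complex.Gamma (c + N))⁻¹) := by
      rw [← ih x c, ← Finset.sum_neg_distrib]
      apply Finset.sum_congr rfl
      intro ij _; ring
    have e2 : ∑ ij ∈ Finset.HasAntidiagonal.antidiagonal N, (N.choose ij.2 : ℂ) *
      ((-1) ^ ij.2 * (ascPochhammer ℂ (ij.1 + 1)).eval x * (Complex.Gamma (c + (ij.1 + 1 : ℕ)))⁻¹) =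
      x * ((ascPochhammer ℂ N).eval (x - c - N + 1) * (Complex.Gamma (c + N + 1))⁻¹) := by
      have := ih (x + 1) (c + 1)
      rw [show x + 1 - (c + 1) - N + 1 = x - c - N + 1 by ring,
        show c + 1 + (N:ℂ) = c + N + 1 by ring] at this
      rw [← this, Finset.mul_sum]
      apply Finset.sum_congr rfl
      intro ij hij
      rw [Finset.HasAntidiagonal.mem_antidiagonal] at hij
      rw [← Nat.choose_symm_of_eq_add hij.symm, ascPochhammer_succ_left]
      simp only [Polynomial.eval_mul, Polynomial.eval_X, Polynomial.eval_comp, Polynomial.eval_add,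
        Polynomial.eval_one]
      push_cast
      rw [show c + 1 + (ij.1:ℂ) = c + (ij.1 + 1) by ring]
      ring
    rw [e1, e2, Complex.one_div_Gamma_eq_self_mul_one_div_Gamma_add_one (c + N),
      ascPochhammer_succ_left]
    have e3 : (ascPochhammer ℂ (N + 1)).eval (x - c - (N+1:ℕ) + 1) =
        (x - c - N) * (ascPochhammer ℂ N).eval (x - c - N + 1) := by
      rw [ascPochhammer_succ_left]
      simp only [Polynomial.eval_mul, Polynomial.eval_X, Polynomial.eval_comp, Polynomial.eval_add,
        Polynomial.eval_one]
      push_cast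
      ring_nf
    rw [← ascPochhammer_succ_left, e3]
    push_cast
    rw [show c + ((N:ℂ) + 1) = c + N + 1 by ring]
    ring

theorem quad_coef (a c : ℂ) (N : ℕ) : ∑ ij ∈ Finset.HasAntidiagonal.antidiagonal N,
    hc (a / 2) ((a + 1) / 2) c ij.1 * 4 ^ ij.1 *
      ((ascPochhammer ℂ ij.2).eval (a + 2 * ij.1) / (ij.2.factorial : ℂ) * (-1) ^ ij.2) =
    hc a (a - c + 1) c N := by
  have hN : (N.factorial : ℂ) ≠ 0 := by exact_mod_cast N.factorial_ne_zero
  have key := vander N (a + N) c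
  rw [show a + N - c - N + 1 = a - c + 1 by ring] at key
  unfold hc
  rw [mul_comm (Complex.Gamma (c + N)), mul_div_mul_comm, div_eq_mul_inv _ (Complex.Gamma _), ← key,
    Finset.mul_sum]
  apply Finset.sum_congr rfl
  intro ij hij
  rw [Finset.HasAntidiagonal.mem_antidiagonal] at hij
  have h1 : (ascPochhammer ℂ N).eval a * (ascPochhammer ℂ ij.1).eval (a + N) =
      (ascPochhammer ℂ ij.1).eval (a / 2) * (ascPochhammer ℂ ij.1).eval ((a + 1) / 2) * 4 ^ ij.1 *
        (ascPochhammer ℂ ij.2).eval (a + 2 * ij.1) := by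
    rw [asc_double, ← asc_add]
    have := asc_add a (2 * ij.1) ij.2
    push_cast at this
    rw [← this]; congr 2; omega
  have h2 : (N.choose ij.1 : ℂ) * ij.1.factorial * ij.2.factorial = N.factorial := by
    have := Nat.add_choose_mul_factorial_mul_factorial ij.1 ij.2
    rw [← hij, Nat.choose_symm_add]; exact_mod_cast this
  have f1 : (ij.1.factorial : ℂ) ≠ 0 := by exact_mod_cast ij.1.factorial_ne_zero
  have f2 : (ij.2.factorial : ℂ) ≠ 0 := by exact_mod_cast ij.2.factorial_ne_zero
  have h3 : (N.choose ij.1 : ℂ) = N.factorial / (ij.1.factorial * ij.2.factorial) := by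
    field_simp; linear_combination h2
  rw [h3, div_eq_mul_inv _ (_ * _), mul_inv]
  generalize (Complex.Gamma (c + ij.1))⁻¹ = G
  field_simp
  linear_combination (-G) * h1

set_option maxHeartbeats 1000000 in
theorem quad_small (a c : ℂ) (p : ℝ) (hp0 : 0 < p) (hp : p < 1 / 10) :
    1 / (1 + (p:ℂ)) ^ a * hyp2F1reg (a / 2) ((a + 1) / 2) c (4 * p / (1 + p) ^ 2) =
      hyp2F1reg a (a - c + 1) c p := by
  set A := hc (a / 2) ((a + 1) / 2) c with hA
  let T : ℕ × ℕ → ℂ := fun q => A q.1 * 4 ^ q.1 *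
      ((ascPochhammer ℂ q.2).eval (a + 2 * q.1) / (q.2.factorial : ℂ) * (-1) ^ q.2) * (p:ℂ) ^ (q.1 + q.2)
  have hp1 : (1 + (p:ℂ)) ≠ 0 := by exact_mod_cast (by linarith : 1 + p ≠ 0)
  have inner : ∀ n, HasSum (fun m => T (n, m))
      (1 / (1 + (p:ℂ)) ^ a * (A n * (4 * p / (1 + p) ^ 2) ^ n)) := by
    intro n
    have h := (binom_hasSum (a + 2 * n) (-p) (by
      rw [norm_neg, Complex.norm_real, Real.norm_eq_abs, abs_of_pos hp0]; linarith)).mul_left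
      (A n * 4 ^ n * (p:ℂ) ^ n)
    refine hs_congr h (fun m => ?_) ?_
    · simp only [T]; rw [pow_add, neg_pow (p:ℂ)]; ring
    · rw [sub_neg_eq_add, Complex.cpow_add _ _ hp1]
      have : (1 + (p:ℂ)) ^ (2 * (n:ℂ)) = ((1 + (p:ℂ)) ^ 2) ^ n := by
        rw [← pow_mul, ← Complex.cpow_natCast]; push_cast; rfl
      rw [this, div_pow, mul_pow]
      field_simp
  have hT : Summable T := by
    apply Summable.of_norm_bounded (g := fun q : ℕ × ℕ => ‖A q.1‖ * 4 ^ q.1 * p ^ q.1 *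
      ((ascPochhammer ℝ q.2).eval (‖a‖ + 2 * q.1) / (q.2.factorial : ℝ) * p ^ q.2))
    · have hin : ∀ n : ℕ, HasSum (fun m : ℕ => ‖A n‖ * 4 ^ n * p ^ n *
        ((ascPochhammer ℝ m).eval (‖a‖ + 2 * n) / (m.factorial : ℝ) * p ^ m))
          (‖A n‖ * 4 ^ n * p ^ n * (1 / (1 - p) ^ (‖a‖ + 2 * n))) := fun n =>
        (rbinom_hasSum (‖a‖ + 2 * n) p (by rw [abs_of_pos hp0]; linarith)).mul_left _
      rw [summable_prod_of_nonneg]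
      · refine ⟨fun n => (hin n).summable, ?_⟩
        have hz : ‖((4 * p / (1 - p) ^ 2 : ℝ) : ℂ)‖ < 1 := by
          rw [Complex.norm_real, Real.norm_eq_abs, abs_of_pos (by
            have : 0 < 1 - p := by linarith
            positivity), div_lt_one (by nlinarith)]
          nlinarith
        have := (hc_summable_norm (a / 2) ((a + 1) / 2) c _ hz).mul_left (1 / (1 - p) ^ ‖a‖)
        refine this.congr fun n => ?_
        rw [(hin n).tsum_eq, norm_mul, norm_pow, Complex.norm_real, Real.norm_eq_abs, abs_of_pos (by
            have : 0 < 1 - p := by linarith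
            positivity), Real.rpow_add (by linarith)]
        have : (1 - p) ^ (2 * (n:ℝ)) = ((1 - p) ^ 2) ^ n := by
          rw [← pow_mul, ← Real.rpow_natCast]; push_cast; rfl
        have h1p : (0:ℝ) < (1 - p) := by linarith
        rw [this, div_pow, mul_pow]
        field_simp
        try ring
      · intro q
        have : 0 ≤ (ascPochhammer ℝ q.2).eval (‖a‖ + 2 * q.1) :=
          (norm_nonneg _).trans (asc_bound (a + 2 * q.1) _ (by
            refine (norm_add_le _ _).trans ?_
            simp) q.2)
        simp only [Pi.zero_apply]
        positivity
    · intro q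
      have hb := asc_bound (a + 2 * q.1) (‖a‖ + 2 * q.1) (by
            refine (norm_add_le _ _).trans ?_
            simp) q.2
      simp only [T, norm_mul, norm_pow, norm_div, norm_neg, norm_one, one_pow, mul_one,
        Complex.norm_natCast, Complex.norm_real, Real.norm_eq_abs, abs_of_pos hp0, pow_add,
        Complex.norm_ofNat]
      calc _ = ‖A q.1‖ * 4 ^ q.1 * p ^ q.1 *
        (‖(ascPochhammer ℂ q.2).eval (a + 2 * q.1)‖ / (q.2.factorial : ℝ) * p ^ q.2) := by ring
        _ ≤ _ := by gcongr
  have s1 := hT.hasSum.prod_fiberwise inner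
  have hz2 : ‖4 * (p:ℂ) / (1 + p) ^ 2‖ < 1 := by
    have : 4 * (p:ℂ) / (1 + p) ^ 2 = ((4 * p / (1 + p) ^ 2 : ℝ) : ℂ) := by push_cast; rfl
    rw [this, Complex.norm_real, Real.norm_eq_abs, abs_of_pos (by positivity), div_lt_one (by positivity)]
    nlinarith
  have s2 := (hc_summable (a / 2) ((a + 1) / 2) c _ hz2).hasSum.mul_left (1 / (1 + (p:ℂ)) ^ a)
  have e1 := s1.unique s2
  have s3 : HasSum (T ∘ Finset.HasAntidiagonal.sigmaAntidiagonalEquivProd) (∑' q, T q) :=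
    (Equiv.hasSum_iff _).2 hT.hasSum
  have s4 := s3.sigma (g := fun N => hc a (a - c + 1) c N * (p:ℂ) ^ N) (fun N => by
    have := hasSum_fintype (fun b : Finset.HasAntidiagonal.antidiagonal N =>
      (T ∘ Finset.HasAntidiagonal.sigmaAntidiagonalEquivProd) ⟨N, b⟩)
    convert this using 1
    rw [← quad_coef a c N, Finset.sum_mul]
    rw [← Finset.sum_coe_sort]
    apply Finset.sum_congr rfl
    intro ij _
    have := Finset.HasAntidiagonal.mem_antidiagonal.1 ij.2
    simp only [Function.comp, T, Finset.HasAntidiagonal.sigmaAntidiagonalEquivProd_apply, this, hA])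
  rw [hyp_eq, hyp_eq, s4.tsum_eq, e1]

open MeasureTheory Set Filter Topology

theorem hyp_analyticAt (a b c z : ℂ) (hz : ‖z‖ < 1) : AnalyticAt ℂ (hyp2F1reg a b c) z :=
  (hyp_diff_z a b c).analyticAt (Metric.isOpen_ball.mem_nhds (by simpa using hz))

theorem real_analytic_of_complex (f : ℂ → ℂ) (p : ℝ) (h : AnalyticAt ℂ f p) :
    AnalyticAt ℝ (fun x : ℝ => f x) p := by
  have h1 : AnalyticAt ℝ f (Complex.ofRealCLM p) := by
    have := h.restrictScalars (𝕜 := ℝ); simpa using this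
  exact h1.comp (Complex.ofRealCLM.analyticAt p)

theorem quad_arg (p : ℝ) (hp0 : 0 < p) (hp : p < 1) : ‖4 * (p:ℂ) / (1 + p) ^ 2‖ < 1 := by
  have : 4 * (p:ℂ) / (1 + p) ^ 2 = ((4 * p / (1 + p) ^ 2 : ℝ) : ℂ) := by push_cast; rfl
  rw [this, Complex.norm_real, Real.norm_eq_abs, abs_of_pos (by positivity), div_lt_one (by positivity)]
  nlinarith [sq_pos_of_pos (sub_pos.2 hp)]

theorem quad_full (a c : ℂ) (p : ℝ) (hp0 : 0 < p) (hp : p < 1) :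
    1 / (1 + (p:ℂ)) ^ a * hyp2F1reg (a / 2) ((a + 1) / 2) c (4 * p / (1 + p) ^ 2) =
      hyp2F1reg a (a - c + 1) c p := by
  have hf : AnalyticOnNhd ℝ (fun x : ℝ => 1 / (1 + (x:ℂ)) ^ a *
      hyp2F1reg (a / 2) ((a + 1) / 2) c (4 * x / (1 + x) ^ 2)) (Ioo 0 1) := by
    intro x hx
    have h1 : (1 + (x:ℂ)) ≠ 0 := by exact_mod_cast (by linarith [hx.1] : 1 + x ≠ 0)
    have h2 : (1 + (x:ℂ)) ∈ Complex.slitPlane := by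
      have : (1 + (x:ℂ)) = ((1 + x : ℝ) : ℂ) := by push_cast; rfl
      rw [this, Complex.ofReal_mem_slitPlane]; linarith [hx.1]
    apply real_analytic_of_complex (fun w : ℂ => 1 / (1 + w) ^ a *
      hyp2F1reg (a / 2) ((a + 1) / 2) c (4 * w / (1 + w) ^ 2))
    have i1 : AnalyticAt ℂ (fun w : ℂ => 1 + w) x := by fun_prop
    refine AnalyticAt.mul ?_ ?_
    · refine analyticAt_const.div (i1.cpow analyticAt_const h2) ?_
      rw [Complex.cpow_ne_zero_iff]; left; exact h1
    · have i2 : AnalyticAt ℂ (fun w : ℂ => 4 * w / (1 + w) ^ 2) x :=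
        (analyticAt_const.mul analyticAt_id).div (i1.pow 2) (pow_ne_zero _ h1)
      exact AnalyticAt.fun_comp (g := hyp2F1reg (a / 2) ((a + 1) / 2) c)
        (hyp_analyticAt _ _ _ _ (quad_arg x hx.1 hx.2)) i2
  have hg : AnalyticOnNhd ℝ (fun x : ℝ => hyp2F1reg a (a - c + 1) c x) (Ioo 0 1) := by
    intro x hx
    exact real_analytic_of_complex _ _ (hyp_analyticAt _ _ _ _ (by
      rw [Complex.norm_real, Real.norm_eq_abs, abs_of_pos hx.1]; exact hx.2))
  refine hf.eqOn_of_preconnected_of_eventuallyEq hg isPreconnected_Ioo (z₀ := 1/20)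
    (by constructor <;> norm_num) ?_ ⟨hp0, hp⟩
  filter_upwards [Ioo_mem_nhds (show (0:ℝ) < 1/20 by norm_num) (show (1/20:ℝ) < 1/10 by norm_num)] with x hx
  exact quad_small a c x hx.1 hx.2

open MeasureTheory Set Filter Topology

theorem cpow_pos {x : ℝ} (hx : 0 < x) (s : ℂ) : (x:ℂ) ^ s = Complex.exp (s * (Real.log x : ℝ)) := by
  rw [Complex.cpow_def_of_ne_zero (by exact_mod_cast hx.ne'), Complex.ofReal_log hx.le, mul_comm]

theorem beta_on (u v : ℂ) (hu : 0 < u.re) (hv : 0 < v.re) :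
    IntegrableOn (fun x : ℝ => (x:ℂ) ^ (u - 1) * ((1 - x : ℝ) : ℂ) ^ (v - 1)) (Ioo 0 1) ∧
    Complex.Gamma (u + v) * ∫ x in Ioo (0:ℝ) 1, (x:ℂ) ^ (u - 1) * ((1 - x : ℝ) : ℂ) ^ (v - 1) =
      Complex.Gamma u * Complex.Gamma v := by
  constructor
  · have := Complex.betaIntegral_convergent hu hv
    rw [intervalIntegrable_iff_integrableOn_Ioo_of_le zero_le_one] at this
    simpa using this
  · rw [Complex.Gamma_mul_Gamma_eq_betaIntegral hu hv, Complex.betaIntegral,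
      intervalIntegral.integral_of_le zero_le_one, integral_Ioc_eq_integral_Ioo]
    simp

theorem euler_int (a b d : ℂ) (hb : 0 < b.re) (hd : 0 < d.re) (p : ℝ) (hp0 : 0 ≤ p) (hp : p < 1) :
    IntegrableOn (fun t : ℝ => (t:ℂ) ^ (b - 1) * ((1 - t : ℝ) : ℂ) ^ (d - 1) *
      ((1 - p * t : ℝ) : ℂ) ^ (-a)) (Ioo 0 1) ∧
    ∫ t in Ioo (0:ℝ) 1, (t:ℂ) ^ (b - 1) * ((1 - t : ℝ) : ℂ) ^ (d - 1) *
      ((1 - p * t : ℝ) : ℂ) ^ (-a) = Complex.Gamma b * Complex.Gamma d * hyp2F1reg a b (b + d) p := by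
  have hpt : ∀ t ∈ Ioo (0:ℝ) 1, p * t < 1 := fun t ht => by nlinarith [ht.1, ht.2]
  obtain ⟨hi, -⟩ := beta_on b d hb hd
  constructor
  · have hcont : ContinuousOn (fun t : ℝ => ((1 - p * t : ℝ) : ℂ) ^ (-a)) (Icc 0 1) := by
      apply ContinuousOn.cpow_const (by fun_prop)
      intro t ht
      rw [Complex.ofReal_mem_slitPlane]
      nlinarith [ht.1, ht.2]
    have hi' := hi
    rw [← integrableOn_Icc_iff_integrableOn_Ioo] at hi' ⊢
    exact hi'.mul_continuousOn hcont isCompact_Icc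
  · let F : ℕ → ℝ → ℂ := fun n t => ((ascPochhammer ℂ n).eval a / (n.factorial : ℂ) * (p:ℂ) ^ n) *
      ((t:ℂ) ^ (b + n - 1) * ((1 - t : ℝ) : ℂ) ^ (d - 1))
    have hbn : ∀ n : ℕ, 0 < (b + n).re := fun n => by
      simp only [Complex.add_re, Complex.natCast_re]; positivity
    have hFi : ∀ n, Integrable (F n) (volume.restrict (Ioo 0 1)) := fun n =>
      (beta_on (b + n) d (hbn n) hd).1.const_mul _
    have hpow : ∀ n : ℕ, ∀ t ∈ Ioo (0:ℝ) 1, (t:ℂ) ^ (b + n - 1) = (t:ℂ) ^ (b - 1) * (t:ℂ) ^ n := by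
      intro n t ht
      rw [← Complex.cpow_natCast, ← Complex.cpow_add _ _ (by exact_mod_cast ht.1.ne')]
      congr 1; ring
    have hsum : Summable fun n => ∫ t in Ioo (0:ℝ) 1, ‖F n t‖ := by
      have hs := ((rbinom_hasSum ‖a‖ p (by rw [abs_of_nonneg hp0]; exact hp)).mul_right
        (∫ t in Ioo (0:ℝ) 1, ‖(t:ℂ) ^ (b - 1) * ((1 - t : ℝ) : ℂ) ^ (d - 1)‖)).summable
      refine Summable.of_nonneg_of_le (fun n => integral_nonneg fun t => norm_nonneg _) (fun n => ?_) hs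
      rw [← integral_const_mul]
      apply setIntegral_mono_on (hFi n).norm (hi.norm.const_mul _) measurableSet_Ioo
      intro t ht
      simp only [F, norm_mul, norm_div, norm_pow, Complex.norm_natCast, Complex.norm_real, Real.norm_eq_abs,
        abs_of_nonneg hp0, hpow n t ht]
      rw [abs_of_pos ht.1]
      have h1 := asc_bound a ‖a‖ le_rfl n
      have h2 : t ^ n ≤ 1 := pow_le_one₀ ht.1.le ht.2.le
      calc _ ≤ ‖(ascPochhammer ℂ n).eval a‖ / (n.factorial : ℝ) * p ^ n *
            (‖(t:ℂ) ^ (b - 1)‖ * 1 * ‖((1 - t : ℝ) : ℂ) ^ (d - 1)‖) := by gcongr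
        _ ≤ _ := by rw [mul_one]; gcongr
    have key := hasSum_integral_of_summable_integral_norm hFi hsum
    have e1 : ∫ t in Ioo (0:ℝ) 1, ∑' n, F n t = ∫ t in Ioo (0:ℝ) 1, (t:ℂ) ^ (b - 1) *
        ((1 - t : ℝ) : ℂ) ^ (d - 1) * ((1 - p * t : ℝ) : ℂ) ^ (-a) := by
      apply setIntegral_congr_fun measurableSet_Ioo
      intro t ht
      have h := (binom_hasSum a (p * t : ℝ) (by
        rw [Complex.norm_real, Real.norm_eq_abs, abs_of_nonneg (mul_nonneg hp0 ht.1.le)]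
        exact hpt t ht)).mul_left ((t:ℂ) ^ (b - 1) * ((1 - t : ℝ) : ℂ) ^ (d - 1))
      have : HasSum (fun n => F n t) _ := hs_congr h (fun n => by
        simp only [F, hpow n t ht]; push_cast; rw [mul_pow]; ring) rfl
      simp only [this.tsum_eq]
      rw [Complex.cpow_neg, one_div]
      push_cast; rfl
    rw [← e1, ← key.tsum_eq, hyp_eq, ← tsum_mul_left]
    congr 1; ext n
    simp only [F]
    rw [integral_const_mul]
    have hg := (beta_on (b + n) d (hbn n) hd).2
    have hG : Complex.Gamma (b + n + d) ≠ 0 := Complex.Gamma_ne_zero_of_re_pos (by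
      simp only [Complex.add_re, Complex.natCast_re]; positivity)
    have hbk : ∀ k : ℕ, b ≠ -k := fun k hk => by
      rw [hk] at hb; simp at hb; linarith [k.cast_nonneg (α := ℝ)]
    have hg2 := Complex.Gamma_add_nat_div_Gamma_eq (n := n) b hbk
    rw [div_eq_iff (Complex.Gamma_ne_zero_of_re_pos hb)] at hg2
    rw [hg2] at hg
    have hint := eq_div_of_mul_eq hG ((mul_comm _ _).trans hg)
    rw [hint, hc, show b + d + (n:ℂ) = b + n + d by ring]
    field_simp

open MeasureTheory Set Filter Topology

theorem J_image (p : ℝ) (hp0 : 0 ≤ p) (hp : p < 1) :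
    (fun s => (1 - Real.exp (-s)) / (1 - p * Real.exp (-s))) '' Ioi 0 = Ioo (0:ℝ) 1 := by
  ext t
  simp only [mem_image, mem_Ioi, mem_Ioo]
  constructor
  · rintro ⟨s, hs, rfl⟩
    have h1 : Real.exp (-s) < 1 := by rw [Real.exp_lt_one_iff]; linarith
    have h2 := Real.exp_pos (-s)
    have h3 : p * Real.exp (-s) < 1 := by nlinarith
    have h4 : 0 < 1 - p * Real.exp (-s) := by linarith
    constructor
    · apply div_pos <;> linarith
    · rw [div_lt_one h4]; nlinarith
  · rintro ⟨h0, h1⟩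
    have h4 : 0 < 1 - p * t := by nlinarith
    have h5 : 0 < (1 - t) / (1 - p * t) := by apply div_pos <;> linarith
    refine ⟨-Real.log ((1 - t) / (1 - p * t)), ?_, ?_⟩
    · rw [neg_pos]
      apply Real.log_neg h5
      rw [div_lt_one h4]; nlinarith
    · rw [neg_neg, Real.exp_log h5]
      have : 1 - p * ((1 - t) / (1 - p * t)) = (1 - p) / (1 - p * t) := by
        field_simp; ring
      rw [this]
      have h6 : 1 - p ≠ 0 := by linarith
      have h7 := h4.ne'
      rw [div_div_eq_mul_div, div_eq_iff h6, sub_mul, div_mul_cancel₀ _ h7]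
      ring

noncomputable def Jk (μ δ : ℂ) (p s : ℝ) : ℂ :=
  Complex.exp (-(δ + 1) * s) * (((1 - Real.exp (-s)) * (1 - p * Real.exp (-s)) : ℝ) : ℂ) ^ (μ - 1 / 2)

theorem J_int (μ δ : ℂ) (hμ : -1 / 2 < μ.re) (hδ : -1 < δ.re) (p : ℝ) (hp0 : 0 ≤ p) (hp : p < 1) :
    IntegrableOn (Jk μ δ p) (Ioi 0) ∧
    ∫ s in Ioi (0:ℝ), Jk μ δ p s = ((1 - p : ℝ) : ℂ) ^ (2 * μ) * (Complex.Gamma (μ + 1 / 2) *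
      Complex.Gamma (δ + 1) * hyp2F1reg (2 * μ + δ + 1) (μ + 1 / 2) (μ + δ + 3 / 2) p) := by
  obtain ⟨h1, h2⟩ := euler_int (2 * μ + δ + 1) (μ + 1 / 2) (δ + 1)
    (by simp; linarith) (by simp; linarith) p hp0 hp
  have hder : ∀ s ∈ Ioi (0:ℝ), HasDerivWithinAt (fun s => (1 - Real.exp (-s)) / (1 - p * Real.exp (-s)))
      (Real.exp (-s) * (1 - p) / (1 - p * Real.exp (-s)) ^ 2) (Ioi 0) s := by
    intro s hs
    have e1 : Real.exp (-s) < 1 := by rw [Real.exp_lt_one_iff]; simpa using hs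
    have e2 := Real.exp_pos (-s)
    have h4 : 1 - p * Real.exp (-s) ≠ 0 := by nlinarith
    have d1 : HasDerivAt (fun s => Real.exp (-s)) (Real.exp (-s) * (-1)) s := (hasDerivAt_neg s).exp
    have := (d1.const_sub 1).div ((d1.const_mul p).const_sub 1) h4
    refine (this.congr_deriv ?_).hasDerivWithinAt
    congr 1; ring
  have hinj : InjOn (fun s => (1 - Real.exp (-s)) / (1 - p * Real.exp (-s))) (Ioi 0) := by
    intro s hs t ht hst
    have e1 : Real.exp (-s) < 1 := by rw [Real.exp_lt_one_iff]; simpa using hs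
    have e2 := Real.exp_pos (-s)
    have f1 : Real.exp (-t) < 1 := by rw [Real.exp_lt_one_iff]; simpa using ht
    have f2 := Real.exp_pos (-t)
    have h4 : 0 < 1 - p * Real.exp (-s) := by nlinarith
    have h5 : 0 < 1 - p * Real.exp (-t) := by nlinarith
    simp only at hst
    rw [div_eq_div_iff h4.ne' h5.ne'] at hst
    have : (1 - p) * (Real.exp (-s) - Real.exp (-t)) = 0 := by linear_combination -hst
    have := (mul_eq_zero.1 this).resolve_left (by linarith)
    have := Real.exp_injective (sub_eq_zero.1 this)
    linarith
  have hpt : ∀ s ∈ Ioi (0:ℝ), |Real.exp (-s) * (1 - p) / (1 - p * Real.exp (-s)) ^ 2| •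
      (fun t : ℝ => (t:ℂ) ^ (μ + 1 / 2 - 1) * ((1 - t : ℝ) : ℂ) ^ (δ + 1 - 1) *
      ((1 - p * t : ℝ) : ℂ) ^ (-(2 * μ + δ + 1))) ((fun s => (1 - Real.exp (-s)) / (1 - p * Real.exp (-s))) s) =
      ((1 - p : ℝ) : ℂ) ^ (-(2 * μ)) * Jk μ δ p s := by
    intro s hs
    have e1 : Real.exp (-s) < 1 := by rw [Real.exp_lt_one_iff]; simpa using hs
    have e2 := Real.exp_pos (-s)
    have h4 : 0 < 1 - p * Real.exp (-s) := by nlinarith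
    have h5 : 0 < 1 - p := by linarith
    have h6 : 0 < 1 - Real.exp (-s) := by linarith
    have i1 : 1 - (1 - Real.exp (-s)) / (1 - p * Real.exp (-s)) =
      Real.exp (-s) * (1 - p) / (1 - p * Real.exp (-s)) := by
      rw [eq_div_iff h4.ne', sub_mul, div_mul_cancel₀ _ h4.ne']; ring
    have i2 : 1 - p * ((1 - Real.exp (-s)) / (1 - p * Real.exp (-s))) =
      (1 - p) / (1 - p * Real.exp (-s)) := by field_simp; ring
    simp only [i1, i2, Jk]
    rw [abs_of_pos (by positivity), Complex.real_smul]
    have i3 : ((Real.exp (-s) * (1 - p) / (1 - p * Real.exp (-s)) ^ 2 : ℝ) : ℂ) =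
      Complex.exp ((Real.log (Real.exp (-s) * (1 - p) / (1 - p * Real.exp (-s)) ^ 2) : ℝ) : ℂ) := by
      rw [← Complex.ofReal_exp, Real.exp_log (by positivity)]
    rw [i3, cpow_pos (by positivity), cpow_pos (by positivity), cpow_pos (by positivity),
      cpow_pos (by positivity), cpow_pos (by positivity), Real.log_div (by positivity) (by positivity),
      Real.log_div (by positivity) (by positivity), Real.log_div (by positivity) (by positivity),
      Real.log_div (by positivity) (by positivity), Real.log_mul (by positivity) (by positivity),
      Real.log_mul (by positivity) (by positivity), Real.log_pow, Real.log_exp,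
      ← Complex.exp_add, ← Complex.exp_add, ← Complex.exp_add, ← Complex.exp_add, ← Complex.exp_add]
    congr 1
    push_cast
    ring
  have hne : ((1 - p : ℝ) : ℂ) ≠ 0 := by exact_mod_cast (by linarith : 1 - p ≠ 0)
  have hcne : ((1 - p : ℝ) : ℂ) ^ (-(2 * μ)) ≠ 0 := by
    rw [Complex.cpow_ne_zero_iff]; left; exact hne
  rw [← J_image p hp0 hp] at h1 h2
  rw [integrableOn_image_iff_integrableOn_abs_deriv_smul measurableSet_Ioi hder hinj,
    integrableOn_congr_fun hpt measurableSet_Ioi] at h1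
  rw [integral_image_eq_integral_abs_deriv_smul measurableSet_Ioi hder hinj,
    setIntegral_congr_fun measurableSet_Ioi hpt, integral_const_mul] at h2
  constructor
  · have := h1.const_mul (((1 - p : ℝ) : ℂ) ^ (-(2 * μ)))⁻¹
    refine this.congr (ae_of_all _ fun s => ?_)
    simp only
    rw [inv_mul_cancel_left₀ hcne]
  · rw [show μ + 1 / 2 + (δ + 1) = μ + δ + 3 / 2 by ring] at h2
    rw [← h2, ← mul_assoc, ← Complex.cpow_add _ _ hne]
    simp

open MeasureTheory Set Filter Topology

noncomputable def qPhi (μ δ : ℂ) (p : ℝ) : ℂ :=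
  hyp2F1reg (2 * μ + δ + 1) (μ + 1 / 2) (μ + δ + 3 / 2) p

noncomputable def qA (μ δ : ℂ) (p1 p2 y : ℝ) : ℂ :=
  qPhi μ δ (p1 * p2 * y ^ 2) * ((1 - p1 * p2 * y ^ 2 : ℝ) : ℂ) *
    (((1 - p1 * p2 * y) * (1 - p1 * y) * (1 - p2 * y) : ℝ) : ℂ) ^ (μ - 1 / 2)

noncomputable def qK (μ δ : ℂ) (s : ℝ) : ℂ :=
  Complex.exp (-(δ + 1) * s) * ((1 - Real.exp (-s) : ℝ) : ℂ) ^ (μ - 1 / 2)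

theorem qE_pos (μ δ : ℂ) (hμ : -1 / 2 < μ.re) (hδ : -1 < δ.re) {p1 p2 : ℝ} (hp1 : 0 < p1) (hp1' : p1 < 1)
    (hp2 : 0 < p2) (hp2' : p2 < 1) :
    IntegrableOn (fun s => qK μ δ s * qA μ δ p1 p2 (Real.exp (-s))) (Ioi 0) ∧
    ∫ s in Ioi (0:ℝ), qK μ δ s * qA μ δ p1 p2 (Real.exp (-s)) =
      ((1 - p1 : ℝ) : ℂ) ^ (2 * μ) * ((1 - p2 : ℝ) : ℂ) ^ (2 * μ) * qPhi μ δ p1 * qPhi μ δ p2 *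
        (Complex.Gamma (μ + 1 / 2) * Complex.Gamma (δ + 1)) := by
  set G : ℝ × ℝ → ℂ := fun q => Complex.exp (-(δ + 1) * q.1) * (q.2 : ℂ) ^ (μ - 1 / 2) with hGdef
  have hG : Measurable G := by
    apply Measurable.mul
    · fun_prop
    · exact (Complex.measurable_ofReal.comp measurable_snd).pow_const _
  obtain ⟨j1, j1'⟩ := J_int μ δ hμ hδ p1 hp1.le hp1'
  obtain ⟨j2, j2'⟩ := J_int μ δ hμ hδ p2 hp2.le hp2'
  have hms : MeasurableSet (Ioi (0:ℝ) ×ˢ Ioi (0:ℝ)) := measurableSet_Ioi.prod measurableSet_Ioi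
  have hexp : ∀ s ∈ Ioi (0:ℝ), 0 < 1 - Real.exp (-s) ∧ 0 < Real.exp (-s) := fun s hs =>
    ⟨by have : Real.exp (-s) < 1 := by
          rw [Real.exp_lt_one_iff]; simpa using hs
        linarith, Real.exp_pos _⟩
  have hR : ∀ q ∈ Ioi (0:ℝ) ×ˢ Ioi (0:ℝ), Jk μ δ p1 q.1 * Jk μ δ p2 q.2 =
      G (q.1 + q.2, qqR p1 p2 (q.1 + q.2) q.1) := by
    rintro ⟨s, t⟩ ⟨hs, ht⟩
    simp only at hs ht
    obtain ⟨a1, a2⟩ := hexp s hs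
    obtain ⟨b1, b2⟩ := hexp t ht
    have c1 : 0 < 1 - p1 * Real.exp (-s) := by nlinarith
    have c2 : 0 < 1 - p2 * Real.exp (-t) := by nlinarith
    simp only [Jk, hGdef, qqR, add_sub_cancel_left]
    rw [cpow_pos (by positivity), cpow_pos (by positivity), cpow_pos (by positivity),
      show (1 - Real.exp (-s)) * (1 - p1 * Real.exp (-s)) * (1 - Real.exp (-t)) * (1 - p2 * Real.exp (-t)) =
      ((1 - Real.exp (-s)) * (1 - p1 * Real.exp (-s))) * ((1 - Real.exp (-t)) * (1 - p2 * Real.exp (-t))) by ring,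
      Real.log_mul (x := (1 - Real.exp (-s)) * (1 - p1 * Real.exp (-s))) (by positivity) (by positivity),
      ← Complex.exp_add, ← Complex.exp_add, ← Complex.exp_add, ← Complex.exp_add]
    congr 1
    push_cast; ring
  have haeR : (fun q : ℝ × ℝ => Jk μ δ p1 q.1 * Jk μ δ p2 q.2) =ᵐ[(volume.restrict (Ioi (0:ℝ))).prod
      (volume.restrict (Ioi (0:ℝ)))] fun q => G (q.1 + q.2, qqR p1 p2 (q.1 + q.2) q.1) := by
    rw [Measure.prod_restrict]
    exact ae_restrict_of_forall_mem hms hR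
  have hi := (j1.mul_prod j2).congr haeR
  obtain ⟨hS, hSR⟩ := qq_transfer hp1 hp1' hp2 hp2' G hG hi
  set w : ℝ → ℂ := fun s => qK μ δ s * (((1 - p1 * p2 * Real.exp (-s)) * (1 - p1 * Real.exp (-s)) *
    (1 - p2 * Real.exp (-s)) : ℝ) : ℂ) ^ (μ - 1 / 2) *
    ((1 - p1 * p2 * Real.exp (-s) ^ 2 : ℝ) : ℂ) ^ (1 - 2 * μ) with hw
  have hP : ∀ s ∈ Ioi (0:ℝ), 0 < p1 * p2 * Real.exp (-s) ^ 2 ∧ p1 * p2 * Real.exp (-s) ^ 2 < 1 := by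
    intro s hs
    obtain ⟨a1, a2⟩ := hexp s hs
    refine ⟨by positivity, ?_⟩
    have : Real.exp (-s) ^ 2 < 1 := by nlinarith
    have : p1 * p2 < 1 := by nlinarith
    nlinarith [mul_pos hp1 hp2]
  have hSp : ∀ q ∈ Ioi (0:ℝ) ×ˢ Ioi (0:ℝ), G (q.1 + q.2, qqS p1 p2 (q.1 + q.2) q.1) =
      w q.1 * Jk μ δ (p1 * p2 * Real.exp (-q.1) ^ 2) q.2 := by
    rintro ⟨s, t⟩ ⟨hs, ht⟩
    simp only at hs ht
    obtain ⟨a1, a2⟩ := hexp s hs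
    obtain ⟨b1, b2⟩ := hexp t ht
    obtain ⟨d1, d2⟩ := hP s hs
    have d3 : 0 < 1 - p1 * p2 * Real.exp (-s) ^ 2 := by linarith
    have c1 : 0 < 1 - p1 * Real.exp (-s) := by nlinarith
    have c2 : 0 < 1 - p2 * Real.exp (-s) := by nlinarith
    have c3 : 0 < 1 - p1 * p2 * Real.exp (-s) := by
      have : p1 * p2 < 1 := by nlinarith
      nlinarith [mul_pos hp1 hp2]
    have c4 : 0 < 1 - p1 * p2 * Real.exp (-s) ^ 2 * Real.exp (-t) := by nlinarith
    simp only [Jk, hGdef, qqS, add_sub_cancel_left, hw, qK]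
    rw [cpow_pos (by positivity), cpow_pos (by positivity), cpow_pos (by positivity),
      cpow_pos (by positivity), cpow_pos (by positivity),
      Real.log_div (by positivity) (by positivity), Real.log_pow,
      Real.log_mul (by positivity) c4.ne', Real.log_mul (by positivity) b1.ne',
      Real.log_mul (by positivity) c2.ne', Real.log_mul (by positivity) c1.ne',
      Real.log_mul (by positivity) c3.ne', Real.log_mul (by positivity) c2.ne',
      Real.log_mul (by positivity) c1.ne', Real.log_mul b1.ne' c4.ne',
      ← Complex.exp_add, ← Complex.exp_add, ← Complex.exp_add, ← Complex.exp_add, ← Complex.exp_add,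
      ← Complex.exp_add]
    congr 1
    push_cast; ring
  have haeS : (fun q : ℝ × ℝ => G (q.1 + q.2, qqS p1 p2 (q.1 + q.2) q.1)) =ᵐ[(volume.restrict (Ioi (0:ℝ))).prod
      (volume.restrict (Ioi (0:ℝ)))] fun q => w q.1 * Jk μ δ (p1 * p2 * Real.exp (-q.1) ^ 2) q.2 := by
    rw [Measure.prod_restrict]
    exact ae_restrict_of_forall_mem hms hSp
  have hS2 := hS.congr haeS
  set g := Complex.Gamma (μ + 1 / 2) * Complex.Gamma (δ + 1) with hg
  have hg0 : g ≠ 0 := mul_ne_zero (Complex.Gamma_ne_zero_of_re_pos (by simp; linarith))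
    (Complex.Gamma_ne_zero_of_re_pos (by simp; linarith))
  have hin : ∀ s ∈ Ioi (0:ℝ), ∫ t in Ioi (0:ℝ), w s * Jk μ δ (p1 * p2 * Real.exp (-s) ^ 2) t =
      g * (qK μ δ s * qA μ δ p1 p2 (Real.exp (-s))) := by
    intro s hs
    obtain ⟨d1, d2⟩ := hP s hs
    have hne : ((1 - p1 * p2 * Real.exp (-s) ^ 2 : ℝ) : ℂ) ≠ 0 := by
      exact_mod_cast (by linarith : 1 - p1 * p2 * Real.exp (-s) ^ 2 ≠ 0)
    rw [integral_const_mul, (J_int μ δ hμ hδ _ d1.le d2).2]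
    have e : ((1 - p1 * p2 * Real.exp (-s) ^ 2 : ℝ) : ℂ) = ((1 - p1 * p2 * Real.exp (-s) ^ 2 : ℝ) : ℂ) ^ (1 - 2 * μ) *
       ((1 - p1 * p2 * Real.exp (-s) ^ 2 : ℝ) : ℂ) ^ (2 * μ) := by
      rw [← Complex.cpow_add _ _ hne]; simp
    simp only [hw, qA, qPhi]
    rw [hg]
    conv_rhs => rw [e]
    ring
  have k1 := hS2.integral_prod_left
  have k2 : IntegrableOn (fun s => g * (qK μ δ s * qA μ δ p1 p2 (Real.exp (-s)))) (Ioi 0) :=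
    k1.congr (ae_restrict_of_forall_mem measurableSet_Ioi hin)
  constructor
  · refine (k2.const_mul g⁻¹).congr (ae_of_all _ fun s => ?_)
    simp only
    rw [inv_mul_cancel_left₀ hg0]
  · rw [integral_congr_ae haeS, ← integral_congr_ae haeR, integral_prod _ hS2,
      integral_prod_mul (Jk μ δ p1) (Jk μ δ p2), j1', j2',
      setIntegral_congr_fun measurableSet_Ioi hin, integral_const_mul] at hSR
    apply mul_left_cancel₀ hg0
    rw [hSR]
    simp only [qPhi]
    ring

open MeasureTheory Set Filter Topology

theorem exp_lip (M : ℝ) (u v : ℂ) (hu : ‖u‖ ≤ M) (hv : ‖v‖ ≤ M) :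
    ‖Complex.exp u - Complex.exp v‖ ≤ Real.exp M * ‖u - v‖ := by
  apply (convex_closedBall (0:ℂ) M).norm_image_sub_le_of_norm_deriv_le (f := Complex.exp)
    (fun x _ => Complex.differentiable_exp x) (fun x hx => ?_) (by simpa using hv) (by simpa using hu)
  rw [Complex.deriv_exp, Complex.norm_exp]
  apply Real.exp_le_exp.2
  exact (Complex.re_le_norm x).trans (by simpa using hx)

theorem log_lip (m u v : ℝ) (hm : 0 < m) (hu : m ≤ u) (hv : m ≤ v) :
    |Real.log u - Real.log v| ≤ |u - v| / m := by
  have key : ∀ u v : ℝ, m ≤ u → m ≤ v → Real.log u - Real.log v ≤ |u - v| / m := by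
    intro u v hu hv
    have hu0 : 0 < u := by linarith
    have hv0 : 0 < v := by linarith
    rw [← Real.log_div hu0.ne' hv0.ne']
    refine (Real.log_le_sub_one_of_pos (by positivity)).trans ?_
    rw [div_sub_one hv0.ne']
    calc (u - v) / v ≤ |u - v| / v := by gcongr; exact le_abs_self _
      _ ≤ _ := by gcongr
  rw [abs_le]
  constructor
  · have := key v u hv hu
    rw [abs_sub_comm] at this; linarith
  · exact key u v hu hv

theorem prod_lip (f g f' g' : ℂ) (Mf Mg Lf Lg d : ℝ) (hf : ‖f‖ ≤ Mf) (hg : ‖g'‖ ≤ Mg)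
    (h1 : ‖f - f'‖ ≤ Lf * d) (h2 : ‖g - g'‖ ≤ Lg * d) :
    ‖f * g - f' * g'‖ ≤ (Mf * Lg + Lf * Mg) * d := by
  rw [show f * g - f' * g' = f * (g - g') + (f - f') * g' by ring]
  refine (norm_add_le _ _).trans ?_
  rw [norm_mul, norm_mul]
  have a1 : ‖f‖ * ‖g - g'‖ ≤ Mf * (Lg * d) :=
    mul_le_mul hf h2 (norm_nonneg _) ((norm_nonneg _).trans hf)
  have a2 : ‖f - f'‖ * ‖g'‖ ≤ Lf * d * Mg :=
    mul_le_mul h1 hg (norm_nonneg _) ((norm_nonneg _).trans h1)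
  linarith

set_option maxHeartbeats 2000000 in
theorem qA_lip (δ : ℂ) {p1 p2 : ℝ} (hp1 : 0 < p1) (hp1' : p1 < 1) (hp2 : 0 < p2) (hp2' : p2 < 1) (K : ℝ)
    (hK : 0 ≤ K) :
    ∃ C : ℝ, 0 ≤ C ∧ ∀ μ : ℂ, ‖μ‖ ≤ K → ∀ y ∈ Icc (0:ℝ) 1,
      ‖qA μ δ p1 p2 y - qA μ δ p1 p2 1‖ ≤ C * (1 - y) := by
  obtain ⟨P, hPdef⟩ : ∃ P, P = p1 * p2 := ⟨_, rfl⟩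
  have hP0 : 0 < P := hPdef ▸ mul_pos hp1 hp2
  have hP1 : P < 1 := by nlinarith
  obtain ⟨K', hK'⟩ : ∃ x, x = 2 * K + ‖δ‖ + 2 := ⟨_, rfl⟩
  obtain ⟨M, hM0, hM⟩ := hyp_bound K' P hP0.le hP1
  obtain ⟨L, hL0, hL⟩ := hyp_lip K' P hP0.le hP1
  obtain ⟨D, hD⟩ : ∃ x, x = 1 / (1 - P) + 1 / (1 - p1) + 1 / (1 - p2) := ⟨_, rfl⟩
  have q1 : 0 < 1 - P := by linarith
  have q2 : 0 < 1 - p1 := by linarith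
  have q3 : 0 < 1 - p2 := by linarith
  have hD0 : 0 < D := by rw [hD]; positivity
  obtain ⟨E, hE⟩ : ∃ x, x = Real.exp ((K + 1) * D) := ⟨_, rfl⟩
  obtain ⟨c1, hc1⟩ : ∃ x, x = M * 2 + (L * 2) * 1 := ⟨_, rfl⟩
  obtain ⟨C, hC⟩ : ∃ x, x = M * (E * ((K + 1) * D)) + c1 * E := ⟨_, rfl⟩
  have hE0 : 0 < E := hE ▸ Real.exp_pos _
  refine ⟨C, by rw [hC, hc1]; positivity, ?_⟩
  intro μ hμ y hy
  obtain ⟨y0, y1⟩ := hy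
  obtain ⟨d, hd⟩ : ∃ x, x = 1 - y := ⟨_, rfl⟩
  have hd0 : 0 ≤ d := by linarith
  have ka : ‖2 * μ + δ + 1‖ ≤ K' := by
    refine (norm_add₃_le).trans ?_
    rw [norm_mul]; simp; linarith [norm_nonneg δ]
  have kb : ‖μ + 1 / 2‖ ≤ K' := by
    refine (norm_add_le _ _).trans ?_
    simp; linarith [norm_nonneg δ]
  have kc : ‖μ + δ + 3 / 2‖ ≤ K' := by
    refine (norm_add₃_le).trans ?_
    simp; linarith [norm_nonneg δ]
  have hy2 : y ^ 2 ≤ 1 := by nlinarith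
  have n1 : ‖((P * y ^ 2 : ℝ) : ℂ)‖ ≤ P := by
    rw [Complex.norm_real, Real.norm_eq_abs, abs_of_nonneg (by positivity)]; nlinarith
  have n2 : ‖((P * 1 ^ 2 : ℝ) : ℂ)‖ ≤ P := by
    rw [Complex.norm_real, Real.norm_eq_abs, abs_of_nonneg (by positivity)]; simp
  have dP : ‖((P * y ^ 2 : ℝ) : ℂ) - ((P * 1 ^ 2 : ℝ) : ℂ)‖ ≤ 2 * d := by
    rw [← Complex.ofReal_sub, Complex.norm_real, Real.norm_eq_abs,
      show P * y ^ 2 - P * 1 ^ 2 = - (P * ((1 + y) * d)) by rw [hd]; ring, abs_neg, abs_of_nonneg (by positivity)]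
    have : (1 + y) * d ≤ 2 * d := by nlinarith
    nlinarith [mul_nonneg (by linarith : (0:ℝ) ≤ 1 + y) hd0]
  have b1 : ‖qPhi μ δ (P * y ^ 2)‖ ≤ M := hM _ _ _ _ ka kb kc n1
  have s1 : ‖qPhi μ δ (P * y ^ 2) - qPhi μ δ (P * 1 ^ 2)‖ ≤ (L * 2) * d := by
    refine (hL _ _ _ _ _ ka kb kc n1 n2).trans ?_
    rw [mul_assoc L]; gcongr
  have s2 : ‖((1 - P * y ^ 2 : ℝ) : ℂ) - ((1 - P * 1 ^ 2 : ℝ) : ℂ)‖ ≤ 2 * d := by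
    rw [show ((1 - P * y ^ 2 : ℝ) : ℂ) - ((1 - P * 1 ^ 2 : ℝ) : ℂ) =
      -(((P * y ^ 2 : ℝ) : ℂ) - ((P * 1 ^ 2 : ℝ) : ℂ)) by push_cast; ring, norm_neg]
    exact dP
  have m2 : ∀ x ∈ Icc (0:ℝ) 1, ‖((1 - P * x ^ 2 : ℝ) : ℂ)‖ ≤ 1 := by
    intro x hx
    have : x ^ 2 ≤ 1 := by nlinarith [hx.1, hx.2]
    rw [Complex.norm_real, Real.norm_eq_abs, abs_le]
    have h3 : 0 ≤ P * x ^ 2 := by positivity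
    have h4 : P * x ^ 2 ≤ 1 := by
      calc P * x ^ 2 ≤ 1 * 1 := by gcongr
        _ = 1 := by norm_num
    constructor <;> linarith
  have t1 := prod_lip (qPhi μ δ (P * y ^ 2)) ((1 - P * y ^ 2 : ℝ) : ℂ) (qPhi μ δ (P * 1 ^ 2))
    ((1 - P * 1 ^ 2 : ℝ) : ℂ) M 1 (L * 2) 2 d b1 (m2 1 (by simp)) s1 s2
  have hpos : ∀ p x : ℝ, 0 < p → p < 1 → x ∈ Icc (0:ℝ) 1 → 1 - p ≤ 1 - p * x := by
    intro p x h1 h2 h3; have := mul_le_of_le_one_right h1.le h3.2; linarith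
  have l1 : ∀ p x x' : ℝ, 0 < p → p < 1 → x ∈ Icc (0:ℝ) 1 → x' ∈ Icc (0:ℝ) 1 →
      |Real.log (1 - p * x) - Real.log (1 - p * x')| ≤ 1 / (1 - p) * |x - x'| := by
    intro p x x' h1 h2 h3 h4
    refine (log_lip (1 - p) _ _ (by linarith) (hpos p x h1 h2 h3) (hpos p x' h1 h2 h4)).trans ?_
    rw [show 1 - p * x - (1 - p * x') = -(p * (x - x')) by ring, abs_neg, abs_mul, abs_of_pos h1, div_mul_eq_mul_div]
    have : 0 < 1 - p := by linarith
    gcongr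
  obtain ⟨ell, hell⟩ : ∃ ell : ℝ → ℝ, ell = fun x => Real.log ((1 - P * x) * (1 - p1 * x) * (1 - p2 * x)) := ⟨_, rfl⟩
  have hellpos : ∀ x ∈ Icc (0:ℝ) 1, 0 < 1 - P * x ∧ 0 < 1 - p1 * x ∧ 0 < 1 - p2 * x := fun x hx =>
    ⟨by linarith [hpos P x hP0 hP1 hx], by linarith [hpos p1 x hp1 hp1' hx], by linarith [hpos p2 x hp2 hp2' hx]⟩
  have hl : ∀ x ∈ Icc (0:ℝ) 1, ∀ x' ∈ Icc (0:ℝ) 1, |ell x - ell x'| ≤ D * |x - x'| := by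
    intro x hx x' hx'
    obtain ⟨a1, a2, a3⟩ := hellpos x hx
    obtain ⟨b1, b2, b3⟩ := hellpos x' hx'
    simp only [hell]
    rw [Real.log_mul (by positivity) a3.ne', Real.log_mul a1.ne' a2.ne',
      Real.log_mul (by positivity) b3.ne', Real.log_mul b1.ne' b2.ne', hD]
    have h1 := abs_le.1 (l1 P x x' hP0 hP1 hx hx')
    have h2 := abs_le.1 (l1 p1 x x' hp1 hp1' hx hx')
    have h3 := abs_le.1 (l1 p2 x x' hp2 hp2' hx hx')
    rw [abs_le]
    constructor
    · linarith [h1.1, h2.1, h3.1]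
    · linarith [h1.2, h2.2, h3.2]
  have hlb : ∀ x ∈ Icc (0:ℝ) 1, |ell x| ≤ D := by
    intro x hx
    have := hl x hx 0 (by simp)
    have e0 : ell 0 = 0 := by simp [hell]
    rw [e0, sub_zero, sub_zero, abs_of_nonneg hx.1] at this
    nlinarith [hx.2]
  have kmu : ‖μ - 1 / 2‖ ≤ K + 1 := by
    refine (norm_sub_le _ _).trans ?_
    simp; linarith
  have hpw : ∀ x ∈ Icc (0:ℝ) 1, (((1 - P * x) * (1 - p1 * x) * (1 - p2 * x) : ℝ) : ℂ) ^ (μ - 1 / 2) =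
      Complex.exp ((μ - 1 / 2) * (ell x : ℝ)) := by
    intro x hx
    obtain ⟨a1, a2, a3⟩ := hellpos x hx
    rw [hell]; exact cpow_pos (by positivity) _
  have hen : ∀ x ∈ Icc (0:ℝ) 1, ‖(μ - 1 / 2) * (ell x : ℂ)‖ ≤ (K + 1) * D := by
    intro x hx
    rw [norm_mul, Complex.norm_real, Real.norm_eq_abs]
    exact mul_le_mul kmu (hlb x hx) (abs_nonneg _) (by positivity)
  have h1m : (1:ℝ) ∈ Icc (0:ℝ) 1 := by simp
  have hym : y ∈ Icc (0:ℝ) 1 := ⟨y0, y1⟩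
  have s3 : ‖(((1 - P * y) * (1 - p1 * y) * (1 - p2 * y) : ℝ) : ℂ) ^ (μ - 1 / 2) -
      (((1 - P * 1) * (1 - p1 * 1) * (1 - p2 * 1) : ℝ) : ℂ) ^ (μ - 1 / 2)‖ ≤ (E * ((K + 1) * D)) * d := by
    rw [hpw y hym, hpw 1 h1m]
    refine (exp_lip _ _ _ (hen y hym) (hen 1 h1m)).trans ?_
    rw [← mul_sub, norm_mul, ← Complex.ofReal_sub, Complex.norm_real, Real.norm_eq_abs]
    have := hl y hym 1 h1m
    rw [abs_sub_comm y 1, ← hd, abs_of_nonneg hd0] at this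
    rw [← hE, mul_assoc, mul_assoc (K + 1)]
    gcongr
  have m3 : ‖(((1 - P * 1) * (1 - p1 * 1) * (1 - p2 * 1) : ℝ) : ℂ) ^ (μ - 1 / 2)‖ ≤ E := by
    rw [hpw 1 h1m, Complex.norm_exp]
    rw [hE]
    exact Real.exp_le_exp.2 ((Complex.re_le_norm _).trans (hen 1 h1m))
  have m12 : ‖qPhi μ δ (P * y ^ 2) * ((1 - P * y ^ 2 : ℝ) : ℂ)‖ ≤ M := by
    rw [norm_mul]
    calc _ ≤ M * 1 := mul_le_mul b1 (m2 y hym) (norm_nonneg _) hM0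
      _ = M := mul_one _
  rw [← hc1] at t1
  unfold qA
  rw [← hPdef, hC, ← hd]
  exact prod_lip _ _ _ _ M E c1 _ d m12 m3 t1 s3

open MeasureTheory Set Filter Topology

theorem param_diff (ν : Measure ℝ) (f : ℂ → ℝ → ℂ) (z0 : ℂ) (r : ℝ) (hr : 0 < r) (bound : ℝ → ℝ)
    (hm : ∀ z, AEStronglyMeasurable (f z) ν) (hd : ∀ᵐ s ∂ν, Differentiable ℂ (fun z => f z s))
    (hb : ∀ᵐ s ∂ν, ∀ z ∈ Metric.closedBall z0 (2 * r), ‖f z s‖ ≤ bound s) (hbi : Integrable bound ν) :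
    DifferentiableAt ℂ (fun z => ∫ s, f z s ∂ν) z0 := by
  have := hasDerivAt_integral_of_dominated_loc_of_deriv_le (𝕜 := ℂ) (μ := ν) (F := f) (x₀ := z0)
    (s := Metric.ball z0 r) (bound := fun s => bound s / r) (F' := fun z s => deriv (fun z => f z s) z)
    (Metric.ball_mem_nhds z0 hr) (Eventually.of_forall hm) ?_ ?_ ?_ (hbi.div_const r) ?_
  · exact this.2.differentiableAt
  · apply hbi.mono' (hm z0)
    filter_upwards [hb] with s hs
    exact hs z0 (by simp; positivity)
  · apply aestronglyMeasurable_of_tendsto_ae atTop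
      (f := fun (n : ℕ) s => ((n:ℂ) + 1) * (f (z0 + ((n:ℂ) + 1)⁻¹) s - f z0 s))
    · intro n
      exact ((hm _).sub (hm _)).const_mul _
    · filter_upwards [hd] with s hs
      have h1 := (hs z0).hasDerivAt.tendsto_slope_zero
      have h2 : Tendsto (fun n : ℕ => ((n:ℂ) + 1)⁻¹) atTop (𝓝[≠] 0) := by
        rw [tendsto_nhdsWithin_iff]
        constructor
        · have := tendsto_one_div_add_atTop_nhds_zero_nat (𝕜 := ℂ)
          simpa using this
        · exact Eventually.of_forall fun n => inv_ne_zero (Nat.cast_add_one_ne_zero n)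
      have h3 := h1.comp h2
      simpa [Function.comp_def] using h3
  · filter_upwards [hd, hb] with s hs hs2 z hz
    apply Complex.norm_deriv_le_of_forall_mem_sphere_norm_le hr hs.diffContOnCl
    intro w hw
    apply hs2
    rw [Metric.mem_closedBall]
    rw [Metric.mem_sphere] at hw
    rw [Metric.mem_ball] at hz
    linarith [dist_triangle w z z0]
  · filter_upwards [hd] with s hs z hz
    exact (hs z).hasDerivAt

theorem qK_one (μ δ : ℂ) (s : ℝ) : qK μ δ s = Jk μ δ 0 s := by
  simp [qK, Jk]

theorem qPhi_zero (μ δ : ℂ) : qPhi μ δ 0 = (Complex.Gamma (μ + δ + 3 / 2))⁻¹ := by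
  rw [qPhi, hyp_eq, tsum_eq_single 0]
  · simp [hc]
  · intro n hn; simp [hn]

theorem qK_int (μ δ : ℂ) (hμ : -1 / 2 < μ.re) (hδ : -1 < δ.re) : IntegrableOn (qK μ δ) (Ioi 0) ∧
    ∫ s in Ioi (0:ℝ), qK μ δ s = Complex.Gamma (μ + 1 / 2) *
      Complex.Gamma (δ + 1) * (Complex.Gamma (μ + δ + 3 / 2))⁻¹ := by
  have h := J_int μ δ hμ hδ 0 le_rfl zero_lt_one
  rw [← qPhi_zero]
  have e : qK μ δ = Jk μ δ 0 := funext fun s => qK_one μ δ s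
  rw [e]
  refine ⟨h.1, h.2.trans ?_⟩
  simp [qPhi]

theorem qK_norm (μ δ : ℂ) (s : ℝ) (hs : 0 < s) : ‖qK μ δ s‖ =
    Real.exp (-(δ.re + 1) * s) * (1 - Real.exp (-s)) ^ (μ.re - 1 / 2) := by
  have : Real.exp (-s) < 1 := by rw [Real.exp_lt_one_iff]; linarith
  rw [qK, norm_mul, Complex.norm_exp, Complex.norm_cpow_eq_rpow_re_of_pos (by linarith)]
  congr 1
  · congr 1
    simp
  · congr 1; simp

theorem qPhi_cont (μ δ : ℂ) : ContinuousOn (qPhi μ δ) (Ioo (-1) 1) := by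
  apply (hyp_diff_z _ _ _).continuousOn.comp Complex.continuous_ofReal.continuousOn
  intro x hx
  rw [mem_ball_zero_iff, Complex.norm_real, Real.norm_eq_abs, abs_lt]
  exact hx

theorem qA_cont (μ δ : ℂ) {p1 p2 : ℝ} (hp1 : 0 < p1) (hp1' : p1 < 1) (hp2 : 0 < p2) (hp2' : p2 < 1) :
    ContinuousOn (qA μ δ p1 p2) (Icc 0 1) := by
  have hP : p1 * p2 < 1 := by nlinarith
  have hP0 : 0 < p1 * p2 := by positivity
  unfold qA
  refine ContinuousOn.mul (ContinuousOn.mul ?_ (by fun_prop)) ?_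
  · apply (qPhi_cont μ δ).comp (by fun_prop)
    intro y hy
    have : y ^ 2 ≤ 1 := by nlinarith [hy.1, hy.2]
    constructor <;> nlinarith [sq_nonneg y]
  · apply ContinuousOn.cpow_const (by fun_prop)
    intro y hy
    rw [Complex.ofReal_mem_slitPlane]
    have h1 : 0 < 1 - p1 * y := by nlinarith [hy.1, hy.2]
    have h2 : 0 < 1 - p2 * y := by nlinarith [hy.1, hy.2]
    have h3 : 0 < 1 - p1 * p2 * y := by nlinarith [hy.1, hy.2]
    positivity

theorem qK_cont (μ δ : ℂ) : ContinuousOn (qK μ δ) (Ioi 0) := by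
  unfold qK
  refine ContinuousOn.mul (by fun_prop) ?_
  apply ContinuousOn.cpow_const (by fun_prop)
  intro s hs
  rw [Complex.ofReal_mem_slitPlane]
  have : Real.exp (-s) < 1 := by rw [Real.exp_lt_one_iff]; simpa using hs
  linarith

theorem qK_diff (δ : ℂ) (s : ℝ) (hs : 0 < s) : Differentiable ℂ (fun μ => qK μ δ s) := by
  have : Real.exp (-s) < 1 := by rw [Real.exp_lt_one_iff]; linarith
  have h : ((1 - Real.exp (-s) : ℝ) : ℂ) ≠ 0 := by exact_mod_cast (by linarith : 1 - Real.exp (-s) ≠ 0)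
  unfold qK
  intro μ
  refine DifferentiableAt.mul (by fun_prop) ?_
  exact DifferentiableAt.const_cpow (by fun_prop) (Or.inl h)

theorem qPhi_diff (δ : ℂ) (p : ℝ) (h0 : 0 ≤ p) (h1 : p < 1) : Differentiable ℂ (fun μ => qPhi μ δ p) := by
  unfold qPhi
  apply hyp_diff_param (by fun_prop) (by fun_prop) (by fun_prop)
  rw [Complex.norm_real, Real.norm_eq_abs, abs_of_nonneg h0]; exact h1

theorem qA_diff (δ : ℂ) {p1 p2 : ℝ} (hp1 : 0 < p1) (hp1' : p1 < 1) (hp2 : 0 < p2) (hp2' : p2 < 1)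
    (y : ℝ) (hy : y ∈ Icc (0:ℝ) 1) : Differentiable ℂ (fun μ => qA μ δ p1 p2 y) := by
  have hP : p1 * p2 < 1 := by nlinarith
  have hP0 : 0 < p1 * p2 := by positivity
  have hy2 : y ^ 2 ≤ 1 := by nlinarith [hy.1, hy.2]
  have h1 : 0 < 1 - p1 * y := by nlinarith [hy.1, hy.2]
  have h2 : 0 < 1 - p2 * y := by nlinarith [hy.1, hy.2]
  have h3 : 0 < 1 - p1 * p2 * y := by nlinarith [hy.1, hy.2]
  have h4 : 0 < (1 - p1 * p2 * y) * (1 - p1 * y) * (1 - p2 * y) := by positivity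
  unfold qA
  intro μ
  refine DifferentiableAt.mul (DifferentiableAt.mul ?_ (by fun_prop)) ?_
  · exact qPhi_diff δ _ (by positivity) (by nlinarith) μ
  · exact DifferentiableAt.const_cpow (by fun_prop) (Or.inl (by exact_mod_cast h4.ne'))

noncomputable def qI (δ : ℂ) (p1 p2 : ℝ) (μ : ℂ) : ℂ :=
  ∫ s in Ioi (0:ℝ), qK μ δ s * (qA μ δ p1 p2 (Real.exp (-s)) - qA μ δ p1 p2 1)

theorem exp_mem (s : ℝ) (hs : 0 < s) : Real.exp (-s) ∈ Icc (0:ℝ) 1 :=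
  ⟨(Real.exp_pos _).le, by rw [Real.exp_le_one_iff]; linarith⟩

theorem qI_diff (δ : ℂ) (hδ : -1 < δ.re) {p1 p2 : ℝ} (hp1 : 0 < p1) (hp1' : p1 < 1) (hp2 : 0 < p2)
    (hp2' : p2 < 1) (μ : ℂ) (hμ : -3 / 2 < μ.re) : DifferentiableAt ℂ (qI δ p1 p2) μ := by
  obtain ⟨r, hr, hr2⟩ : ∃ r : ℝ, 0 < r ∧ -3 / 2 + 4 * r < μ.re :=
    ⟨(μ.re + 3 / 2) / 5, by linarith, by linarith⟩
  obtain ⟨C, hC0, hC⟩ := qA_lip δ hp1 hp1' hp2 hp2' (‖μ‖ + 2 * r) (by positivity)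
  have hint := (qK_int ((-1 / 2 + 2 * r : ℝ) : ℂ) δ (by rw [Complex.ofReal_re]; linarith) hδ).1
  refine param_diff (volume.restrict (Ioi 0)) _ μ r hr
    (fun s => C * ‖qK ((-1 / 2 + 2 * r : ℝ) : ℂ) δ s‖) ?_ ?_ ?_ (hint.norm.const_mul C)
  · intro z
    apply ContinuousOn.aestronglyMeasurable _ measurableSet_Ioi
    refine (qK_cont z δ).mul (ContinuousOn.sub ?_ continuousOn_const)
    exact (qA_cont z δ hp1 hp1' hp2 hp2').comp (by fun_prop) fun s hs => exp_mem s hs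
  · refine ae_restrict_of_forall_mem measurableSet_Ioi fun s hs => ?_
    exact (qK_diff δ s hs).mul ((qA_diff δ hp1 hp1' hp2 hp2' _ (exp_mem s hs)).sub
      (qA_diff δ hp1 hp1' hp2 hp2' 1 (by simp)))
  · refine ae_restrict_of_forall_mem measurableSet_Ioi fun s hs z hz => ?_
    have hs' : 0 < s := hs
    have hz' : ‖z - μ‖ ≤ 2 * r := by rwa [Metric.mem_closedBall, dist_eq_norm] at hz
    have hzn : ‖z‖ ≤ ‖μ‖ + 2 * r := by
      have := norm_add_le μ (z - μ)
      rw [add_sub_cancel] at this; linarith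
    have hzr : -3 / 2 + 2 * r < z.re := by
      have := (abs_le.1 ((Complex.abs_re_le_norm (z - μ)).trans hz')).1
      rw [Complex.sub_re] at this; linarith
    have hb := hC z hzn _ (exp_mem s hs')
    have e1 : Real.exp (-s) < 1 := by rw [Real.exp_lt_one_iff]; linarith
    have e2 := Real.exp_pos (-s)
    have h1 : 0 < 1 - Real.exp (-s) := by linarith
    rw [norm_mul, qK_norm z δ s hs', qK_norm _ δ s hs', Complex.ofReal_re]
    calc _ ≤ Real.exp (-(δ.re + 1) * s) * (1 - Real.exp (-s)) ^ (z.re - 1 / 2) * (C * (1 - Real.exp (-s))) := by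
          gcongr
      _ = C * (Real.exp (-(δ.re + 1) * s) * (1 - Real.exp (-s)) ^ (z.re - 1 / 2 + 1)) := by
          rw [Real.rpow_add_one h1.ne']; ring
      _ ≤ _ := by
          gcongr C * (_ * ?_)
          apply Real.rpow_le_rpow_of_exponent_ge h1 (by linarith)
          linarith

open MeasureTheory Set Filter Topology

theorem qF_cont (δ : ℂ) (hδ : -1 < δ.re) {p1 p2 : ℝ} (hp1 : 0 < p1) (hp1' : p1 < 1) (hp2 : 0 < p2)
    (hp2' : p2 < 1) (μ : ℂ) (hμ : -3 / 2 < μ.re) :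
    ((1 - p1 : ℝ) : ℂ) ^ (2 * μ) * ((1 - p2 : ℝ) : ℂ) ^ (2 * μ) * qPhi μ δ p1 * qPhi μ δ p2 *
        (Complex.Gamma (μ + 3 / 2) * Complex.Gamma (δ + 1)) =
    (μ + 1 / 2) * qI δ p1 p2 μ + qA μ δ p1 p2 1 * (Complex.Gamma (μ + 3 / 2) * Complex.Gamma (δ + 1) *
      (Complex.Gamma (μ + δ + 3 / 2))⁻¹) := by
  have hU : IsOpen {z : ℂ | -3 / 2 < z.re} := isOpen_lt continuous_const Complex.continuous_re
  have hΓ : ∀ z ∈ {z : ℂ | -3 / 2 < z.re}, DifferentiableAt ℂ (fun z => Complex.Gamma (z + 3 / 2)) z := by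
    intro z hz
    have hz' : -3 / 2 < z.re := hz
    refine DifferentiableAt.comp (g := Complex.Gamma) z (Complex.differentiableAt_Gamma _ fun m hm => ?_) (by fun_prop)
    have := congrArg Complex.re hm
    simp at this
    linarith [m.cast_nonneg (α := ℝ)]
  have hΓ2 : Differentiable ℂ (fun z : ℂ => (Complex.Gamma (z + δ + 3 / 2))⁻¹) := by
    have := Complex.differentiable_one_div_Gamma
    exact this.comp (f := fun z : ℂ => z + δ + 3 / 2) (by fun_prop)
  have hpw : ∀ p : ℝ, p < 1 → Differentiable ℂ (fun z : ℂ => ((1 - p : ℝ) : ℂ) ^ (2 * z)) := by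
    intro p hp z
    exact DifferentiableAt.const_cpow (by fun_prop) (Or.inl (by exact_mod_cast (by linarith : 1 - p ≠ 0)))
  have hL : AnalyticOnNhd ℂ (fun μ => ((1 - p1 : ℝ) : ℂ) ^ (2 * μ) * ((1 - p2 : ℝ) : ℂ) ^ (2 * μ) *
      qPhi μ δ p1 * qPhi μ δ p2 * (Complex.Gamma (μ + 3 / 2) * Complex.Gamma (δ + 1)))
      {z : ℂ | -3 / 2 < z.re} := by
    apply DifferentiableOn.analyticOnNhd _ hU
    intro z hz
    apply DifferentiableAt.differentiableWithinAt
    exact ((((hpw p1 hp1' z).mul (hpw p2 hp2' z)).mul (qPhi_diff δ p1 hp1.le hp1' z)).mul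
      (qPhi_diff δ p2 hp2.le hp2' z)).mul ((hΓ z hz).mul_const _)
  have hR : AnalyticOnNhd ℂ (fun μ => (μ + 1 / 2) * qI δ p1 p2 μ + qA μ δ p1 p2 1 *
      (Complex.Gamma (μ + 3 / 2) * Complex.Gamma (δ + 1) * (Complex.Gamma (μ + δ + 3 / 2))⁻¹))
      {z : ℂ | -3 / 2 < z.re} := by
    apply DifferentiableOn.analyticOnNhd _ hU
    intro z hz
    apply DifferentiableAt.differentiableWithinAt
    refine DifferentiableAt.add (DifferentiableAt.mul (by fun_prop) (qI_diff δ hδ hp1 hp1' hp2 hp2' z hz)) ?_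
    exact (qA_diff δ hp1 hp1' hp2 hp2' 1 (by simp) z).mul (((hΓ z hz).mul_const _).mul (hΓ2 z))
  refine hL.eqOn_of_preconnected_of_eventuallyEq hR (convex_halfSpace_re_gt _).isPreconnected (z₀ := 0)
    (by simp only [mem_ofPred_eq, Complex.zero_re]; norm_num) ?_ hμ
  have hV : {z : ℂ | -1 / 2 < z.re} ∈ 𝓝 (0:ℂ) :=
    (isOpen_lt continuous_const Complex.continuous_re).mem_nhds
      (by simp only [mem_ofPred_eq, Complex.zero_re]; norm_num)
  filter_upwards [hV] with z hz
  have hz' : -1 / 2 < z.re := hz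
  obtain ⟨i1, i2⟩ := qE_pos z δ hz' hδ hp1 hp1' hp2 hp2'
  obtain ⟨k1, k2⟩ := qK_int z δ hz' hδ
  have hI : qI δ p1 p2 z = (∫ s in Ioi (0:ℝ), qK z δ s * qA z δ p1 p2 (Real.exp (-s))) -
      (∫ s in Ioi (0:ℝ), qK z δ s) * qA z δ p1 p2 1 := by
    rw [← integral_mul_const, ← integral_sub i1 (k1.mul_const _)]
    simp only [qI, mul_sub]
  have hne : z + 1 / 2 ≠ 0 := fun h0 => by
    have := congrArg Complex.re h0
    simp at this; linarith
  have hG : Complex.Gamma (z + 3 / 2) = (z + 1 / 2) * Complex.Gamma (z + 1 / 2) := by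
    rw [← Complex.Gamma_add_one _ hne]; congr 1; ring
  rw [hI, i2, k2, hG]
  ring

theorem nonint (μ δ : ℂ) (k : ℕ) (hk : μ.re - 1 / 2 + k ≤ -1) (B : ℝ → ℂ) (c : ℂ) (hc : c ≠ 0)
    (hB : Tendsto B (𝓝[>] 0) (𝓝 c)) (g : ℝ → ℂ)
    (hg : ∀ s, 0 < s → g s = qK μ δ s * ((1 - Real.exp (-s) : ℝ) : ℂ) ^ k * B s)
    (hi : IntegrableOn g (Ioi 0)) : False := by
  have h1 : ∀ᶠ s in 𝓝[>] (0:ℝ), ‖c‖ / 2 < ‖B s‖ :=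
    hB.norm.eventually (lt_mem_nhds (half_lt_self (norm_pos_iff.2 hc)))
  have h2 : ∀ᶠ s in 𝓝[>] (0:ℝ), 1 / 2 < Real.exp (-(δ.re + 1) * s) := by
    have : Tendsto (fun s : ℝ => Real.exp (-(δ.re + 1) * s)) (𝓝 0) (𝓝 1) := by
      have : Continuous (fun s : ℝ => Real.exp (-(δ.re + 1) * s)) := by fun_prop
      simpa using this.tendsto 0
    exact (this.mono_left nhdsWithin_le_nhds).eventually (lt_mem_nhds (by norm_num))
  obtain ⟨ε, hε, hsub⟩ := (mem_nhdsGT_iff_exists_Ioo_subset).1 (h1.and h2)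
  have hε' : (0:ℝ) < ε := hε
  have hi2 : IntegrableOn g (Ioo 0 ε) := hi.mono_set fun x hx => hx.1
  have : IntegrableOn (fun s : ℝ => s ^ (μ.re - 1 / 2 + k)) (Ioo 0 ε) := by
    refine Integrable.mono' (g := fun s => (‖c‖ / 4)⁻¹ * ‖g s‖) (hi2.norm.const_mul _) ?_ ?_
    · exact (measurable_id.pow_const _).aestronglyMeasurable
    · refine ae_restrict_of_forall_mem measurableSet_Ioo fun s hs => ?_
      obtain ⟨b1, b2⟩ := hsub hs
      have hs0 : 0 < s := hs.1
      have e1 : Real.exp (-s) < 1 := by rw [Real.exp_lt_one_iff]; linarith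
      have e3 : 0 < 1 - Real.exp (-s) := by linarith
      have e4 : 1 - Real.exp (-s) ≤ s := by linarith [Real.add_one_le_exp (-s)]
      have cpos : 0 < ‖c‖ := norm_pos_iff.2 hc
      rw [Real.norm_eq_abs, abs_of_nonneg (Real.rpow_nonneg hs0.le _), hg s hs0, norm_mul, norm_mul,
        qK_norm μ δ s hs0, norm_pow, Complex.norm_real, Real.norm_eq_abs, abs_of_pos e3]
      rw [le_inv_mul_iff₀ (by positivity)]
      have e5 : s ^ (μ.re - 1 / 2 + k) ≤ (1 - Real.exp (-s)) ^ (μ.re - 1 / 2 + k) :=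
        Real.rpow_le_rpow_of_nonpos e3 e4 (by linarith)
      have e6 : 0 < (1 - Real.exp (-s)) ^ (μ.re - 1 / 2 + k) := Real.rpow_pos_of_pos e3 _
      calc ‖c‖ / 4 * s ^ (μ.re - 1 / 2 + k) ≤ ‖c‖ / 4 * (1 - Real.exp (-s)) ^ (μ.re - 1 / 2 + k) := by gcongr
        _ = (1 / 2) * (1 - Real.exp (-s)) ^ (μ.re - 1 / 2 + k) * (‖c‖ / 2) := by ring
        _ ≤ Real.exp (-(δ.re + 1) * s) * (1 - Real.exp (-s)) ^ (μ.re - 1 / 2 + k) * ‖B s‖ := by gcongr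
        _ = _ := by rw [Real.rpow_add e3, Real.rpow_natCast]; ring
  rw [intervalIntegral.integrableOn_Ioo_rpow_iff hε'] at this
  linarith

open MeasureTheory Set Filter Topology

theorem exp_tendsto : Tendsto (fun s : ℝ => Real.exp (-s)) (𝓝[>] 0) (𝓝[<] 1) := by
  rw [tendsto_nhdsWithin_iff]
  constructor
  · have : Continuous (fun s : ℝ => Real.exp (-s)) := by fun_prop
    have := this.tendsto 0
    simp only [neg_zero, Real.exp_zero] at this
    exact this.mono_left nhdsWithin_le_nhds
  · filter_upwards [self_mem_nhdsWithin] with s hs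
    rw [mem_Iio, Real.exp_lt_one_iff]; simpa using hs

theorem qA_tendsto (μ δ : ℂ) {p1 p2 : ℝ} (hp1 : 0 < p1) (hp1' : p1 < 1) (hp2 : 0 < p2) (hp2' : p2 < 1) :
    Tendsto (fun s : ℝ => qA μ δ p1 p2 (Real.exp (-s))) (𝓝[>] 0) (𝓝 (qA μ δ p1 p2 1)) := by
  have h1 := (qA_cont μ δ hp1 hp1' hp2 hp2') 1 (by simp)
  have h2 : Tendsto (fun s : ℝ => Real.exp (-s)) (𝓝[>] 0) (𝓝[Icc 0 1] 1) := by
    rw [tendsto_nhdsWithin_iff]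
    refine ⟨exp_tendsto.mono_right nhdsWithin_le_nhds, ?_⟩
    filter_upwards [self_mem_nhdsWithin] with s hs
    exact exp_mem s hs
  exact Tendsto.comp h1 h2

theorem qA_one_ne (μ : ℂ) {p1 p2 : ℝ} (hp1 : 0 < p1) (hp1' : p1 < 1) (hp2 : 0 < p2) (hp2' : p2 < 1) :
    ((1 - p1 * p2 * 1 ^ 2 : ℝ) : ℂ) *
    (((1 - p1 * p2 * 1) * (1 - p1 * 1) * (1 - p2 * 1) : ℝ) : ℂ) ^ (μ - 1 / 2) ≠ 0 := by
  have hP : p1 * p2 < 1 := by nlinarith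
  have h1 : 0 < 1 - p1 * 1 := by linarith
  have h2 : 0 < 1 - p2 * 1 := by linarith
  have h3 : 0 < 1 - p1 * p2 * 1 := by linarith
  have h4 : 0 < (1 - p1 * p2 * 1) * (1 - p1 * 1) * (1 - p2 * 1) := by positivity
  apply mul_ne_zero
  · exact_mod_cast (by linarith : 1 - p1 * p2 * 1 ^ 2 ≠ 0)
  · rw [Complex.cpow_ne_zero_iff]; left; exact_mod_cast h4.ne'

theorem qE_all (μ δ : ℂ) (hδ : -1 < δ.re) {p1 p2 : ℝ} (hp1 : 0 < p1) (hp1' : p1 < 1)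
    (hp2 : 0 < p2) (hp2' : p2 < 1)
    (hi : IntegrableOn (fun s => qK μ δ s * qA μ δ p1 p2 (Real.exp (-s))) (Ioi 0)) :
    ((1 - p1 : ℝ) : ℂ) ^ (2 * μ) * ((1 - p2 : ℝ) : ℂ) ^ (2 * μ) * qPhi μ δ p1 * qPhi μ δ p2 =
      (Complex.Gamma (μ + 1 / 2) * Complex.Gamma (δ + 1))⁻¹ *
      ∫ s in Ioi (0:ℝ), qK μ δ s * qA μ δ p1 p2 (Real.exp (-s)) := by
  have hP : p1 * p2 < 1 := by nlinarith
  have hP0 : 0 < p1 * p2 := by positivity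
  have hd0 : Complex.Gamma (δ + 1) ≠ 0 := Complex.Gamma_ne_zero_of_re_pos (by simp; linarith)
  by_cases hμ : -1 / 2 < μ.re
  · have hg0 : Complex.Gamma (μ + 1 / 2) ≠ 0 := Complex.Gamma_ne_zero_of_re_pos (by simp; linarith)
    rw [(qE_pos μ δ hμ hδ hp1 hp1' hp2 hp2').2, eq_inv_mul_iff_mul_eq₀ (mul_ne_zero hg0 hd0)]
    ring
  push Not at hμ
  have hA : qA μ δ p1 p2 1 = 0 := by
    by_contra hne
    refine nonint μ δ 0 (by simp; linarith) _ _ hne (qA_tendsto μ δ hp1 hp1' hp2 hp2') _ (fun s hs => ?_) hi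
    simp
  have hΦ : qPhi μ δ (p1 * p2) = 0 := by
    have := hA
    rw [qA, mul_assoc] at this
    have := (mul_eq_zero.1 this).resolve_right (qA_one_ne μ hp1 hp1' hp2 hp2')
    simpa using this
  by_cases hμ2 : -3 / 2 < μ.re
  · have hne : μ + 1 / 2 ≠ 0 := by
      intro h0
      have hm : μ = -1 / 2 := by linear_combination h0
      have : qPhi μ δ (p1 * p2) = (Complex.Gamma (δ + 1))⁻¹ := by
        rw [qPhi, hyp_eq, tsum_eq_single 0]
        · have e : μ + δ + 3 / 2 = δ + 1 := by rw [hm]; ring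
          rw [e]; simp [hc]
        · intro n hn
          rw [h0, hc, ascPochhammer_ne_zero_eval_zero _ hn]; simp
      rw [hΦ] at this
      exact inv_ne_zero hd0 this.symm
    have hG : Complex.Gamma (μ + 3 / 2) = (μ + 1 / 2) * Complex.Gamma (μ + 1 / 2) := by
      rw [← Complex.Gamma_add_one _ hne]; congr 1; ring
    have hG0 : Complex.Gamma (μ + 3 / 2) ≠ 0 := Complex.Gamma_ne_zero_of_re_pos (by simp; linarith)
    have hg0 : Complex.Gamma (μ + 1 / 2) ≠ 0 := fun h0 => hG0 (by rw [hG, h0, mul_zero])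
    have key := qF_cont δ hδ hp1 hp1' hp2 hp2' μ hμ2
    rw [hA, zero_mul, add_zero, hG, qI, hA] at key
    simp only [sub_zero] at key
    rw [eq_inv_mul_iff_mul_eq₀ (mul_ne_zero hg0 hd0)]
    apply mul_left_cancel₀ hne
    rw [← key]; ring
  · push Not at hμ2
    have hdz : (2 * μ + δ + 1) * (μ + 1 / 2) *
        hyp2F1reg (2 * μ + δ + 1 + 1) (μ + 1 / 2 + 1) (μ + δ + 3 / 2 + 1) ((p1 * p2 : ℝ) : ℂ) = 0 := by
      set d := (2 * μ + δ + 1) * (μ + 1 / 2) *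
        hyp2F1reg (2 * μ + δ + 1 + 1) (μ + 1 / 2 + 1) (μ + δ + 3 / 2 + 1) ((p1 * p2 : ℝ) : ℂ) with hd
      by_contra hne
      have hder : HasDerivAt (fun y : ℝ => qPhi μ δ (p1 * p2 * y ^ 2)) (d * (2 * (p1 * p2))) 1 := by
        have e1 : HasDerivAt (fun y : ℝ => ((p1 * p2 * y ^ 2 : ℝ) : ℂ)) ((p1 * p2 * 2 : ℝ) : ℂ) (1:ℝ) := by
          apply HasDerivAt.ofReal_comp
          have := ((hasDerivAt_id (1:ℝ)).pow 2).const_mul (p1 * p2)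
          refine this.congr_deriv ?_
          simp
        have e2 := hyp_deriv (2 * μ + δ + 1) (μ + 1 / 2) (μ + δ + 3 / 2) ((p1 * p2 * 1 ^ 2 : ℝ) : ℂ) (by
          rw [Complex.norm_real, Real.norm_eq_abs, abs_of_pos (by positivity)]; linarith)
        have e3 := HasDerivAt.comp (1:ℝ) e2 e1
        refine e3.congr_deriv ?_
        rw [hd]; push_cast; simp only [one_pow, mul_one]; ring
      have hsl := (hder.tendsto_slope).mono_left (nhdsLT_le_nhdsNE (1:ℝ))
      set h : ℝ → ℂ := fun y => ((1 - p1 * p2 * y ^ 2 : ℝ) : ℂ) *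
        (((1 - p1 * p2 * y) * (1 - p1 * y) * (1 - p2 * y) : ℝ) : ℂ) ^ (μ - 1 / 2) with hh
      have hhc : ContinuousAt h 1 := by
        have h1 : 0 < 1 - p1 * 1 := by linarith
        have h2 : 0 < 1 - p2 * 1 := by linarith
        have h3 : 0 < 1 - p1 * p2 * 1 := by linarith
        refine ContinuousAt.mul (by fun_prop) ?_
        refine ContinuousAt.cpow (by fun_prop) continuousAt_const ?_
        rw [Complex.ofReal_mem_slitPlane]
        positivity
      have hprod := (hsl.mul (hhc.tendsto.mono_left nhdsWithin_le_nhds)).comp exp_tendsto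
      refine nonint μ δ 1 (by simp; linarith) _ _ ?_ hprod.neg _ (fun s hs => ?_) hi
      · apply neg_ne_zero.2
        refine mul_ne_zero (mul_ne_zero hne ?_) (qA_one_ne μ hp1 hp1' hp2 hp2')
        exact_mod_cast (by positivity : 2 * (p1 * p2) ≠ 0)
      · have e1 : Real.exp (-s) < 1 := by rw [Real.exp_lt_one_iff]; linarith
        have e2 : ((1 - Real.exp (-s) : ℝ) : ℂ) ≠ 0 := by exact_mod_cast (by linarith : 1 - Real.exp (-s) ≠ 0)
        have e3 : (((Real.exp (-s) - 1)⁻¹ : ℝ) : ℂ) = -((1 - Real.exp (-s) : ℝ) : ℂ)⁻¹ := by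
          rw [← Complex.ofReal_inv, ← Complex.ofReal_neg, ← inv_neg, neg_sub]
        have e4 : qPhi μ δ (p1 * p2 * 1 ^ 2) = 0 := by simpa using hΦ
        simp only [Function.comp, slope, vsub_eq_sub, e4, sub_zero, Complex.real_smul, e3, hh, pow_one, qA]
        field_simp
    have hz := hyp_zero_of_double _ _ _ (p1 * p2) hP0 hP hΦ hdz
    have hq : ∀ p : ℝ, 0 ≤ p → p < 1 → qPhi μ δ p = 0 := fun p h0 h1 => hz p (by
      rw [Complex.norm_real, Real.norm_eq_abs, abs_of_nonneg h0]; exact h1)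
    rw [hq p1 hp1.le hp1', mul_zero, zero_mul]
    have : ∫ s in Ioi (0:ℝ), qK μ δ s * qA μ δ p1 p2 (Real.exp (-s)) = ∫ s in Ioi (0:ℝ), (0:ℂ) := by
      apply setIntegral_congr_fun measurableSet_Ioi
      intro s hs
      have hm := exp_mem s hs
      have : Real.exp (-s) ^ 2 ≤ 1 := by nlinarith [hm.1, hm.2]
      simp only [qA]
      rw [hq _ (by positivity) (by nlinarith)]
      simp
    rw [this]; simp

open MeasureTheory Set Filter Topology

theorem cpow_exp_pos {x : ℝ} (hx : 0 < x) (t : ℝ) (h : Real.log x = t) (s : ℂ) :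
    (x : ℂ) ^ s = Complex.exp (s * (t : ℂ)) := by
  rw [cpow_pos hx, h]

theorem legQ_cosh (ν μ : ℂ) {ξ : ℝ} (hξ : 0 < ξ) :
    legendreQ ν μ (Real.cosh ξ) = (Real.sqrt Real.pi : ℂ) * Complex.exp ((Real.pi : ℂ) * Complex.I * μ) *
      Complex.Gamma (ν + μ + 1) * ((Real.cosh ξ ^ 2 - 1 : ℝ) : ℂ) ^ (μ / 2) *
      (Complex.exp (μ * (Real.log 2 : ℝ)) * Complex.exp (-(ν + μ + 1) * ξ) *
        qPhi μ (ν - μ) (Real.exp (-2 * ξ))) := by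
  obtain ⟨p, hp⟩ : ∃ p, p = Real.exp (-2 * ξ) := ⟨_, rfl⟩
  have hp0 : 0 < p := by rw [hp]; positivity
  have hp1 : p < 1 := by rw [hp, Real.exp_lt_one_iff]; linarith
  have hz : Real.cosh ξ = Real.exp ξ * (1 + p) / 2 := by
    have : Real.exp ξ * p = Real.exp (-ξ) := by rw [hp, ← Real.exp_add]; congr 1; ring
    rw [Real.cosh_eq, mul_add, this, mul_one]
  have hz0 : 0 < Real.cosh ξ := Real.cosh_pos ξ
  have hlog : Real.log (Real.cosh ξ) = ξ + Real.log (1 + p) - Real.log 2 := by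
    rw [hz, Real.log_div (by positivity) (by norm_num), Real.log_mul (by positivity) (by positivity),
      Real.log_exp]
  have hz2 : (1 / (Real.cosh ξ : ℂ) ^ 2) = 4 * p / (1 + p) ^ 2 := by
    have h1 : (1:ℝ) / Real.cosh ξ ^ 2 = 4 * p / (1 + p) ^ 2 := by
      have : Real.exp ξ ^ 2 * p = 1 := by
        rw [hp, ← Real.exp_nat_mul, ← Real.exp_add]; simp
      rw [div_eq_div_iff (by positivity) (by positivity), hz]
      linear_combination (-(1 + p) ^ 2) * this
    exact_mod_cast congrArg (fun x : ℝ => (x : ℂ)) h1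
  have hq := quad_full (ν + μ + 1) (ν + 3 / 2) p hp0 hp1
  rw [show ν + μ + 1 - (ν + 3 / 2) + 1 = μ + 1 / 2 by ring] at hq
  have h1p : ((1 : ℂ) + p) = ((1 + p : ℝ) : ℂ) := by push_cast; ring
  have hΦ : qPhi μ (ν - μ) p = hyp2F1reg (ν + μ + 1) (μ + 1 / 2) (ν + 3 / 2) p := by
    rw [qPhi]; congr 1 <;> ring
  rw [← hp, hΦ, ← hq, legendreQ, hz2, show ν + μ + 2 = ν + μ + 1 + 1 by ring]
  have h2 : (2:ℂ) ^ (-ν - 1) = Complex.exp ((-ν - 1) * (Real.log 2 : ℝ)) := by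
    exact_mod_cast cpow_pos (by norm_num : (0:ℝ) < 2) (-ν - 1)
  have hc2 : ((Real.cosh ξ : ℂ) ^ 2 - 1) = ((Real.cosh ξ ^ 2 - 1 : ℝ) : ℂ) := by push_cast; ring
  rw [hc2, h2, cpow_pos hz0, hlog]
  rw [show (1:ℂ) / (1 + (p:ℂ)) ^ (ν + μ + 1) = Complex.exp (-(ν + μ + 1) * (Real.log (1 + p) : ℝ)) by
    rw [h1p, cpow_pos (by positivity), one_div, ← Complex.exp_neg]; congr 1; ring]
  have e : Complex.exp ((-ν - 1) * (Real.log 2 : ℝ)) *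
      Complex.exp ((-ν - μ - 1) * ((ξ + Real.log (1 + p) - Real.log 2 : ℝ) : ℂ)) =
      Complex.exp (μ * (Real.log 2 : ℝ)) * Complex.exp (-(ν + μ + 1) * ξ) *
      Complex.exp (-(ν + μ + 1) * (Real.log (1 + p) : ℝ)) := by
    rw [← Complex.exp_add, ← Complex.exp_add, ← Complex.exp_add]; congr 1; push_cast; ring
  linear_combination (Real.sqrt Real.pi : ℂ) * Complex.exp ((Real.pi : ℂ) * Complex.I * μ) *
      Complex.Gamma (ν + μ + 1) * ((Real.cosh ξ ^ 2 - 1 : ℝ) : ℂ) ^ (μ / 2) *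
      hyp2F1reg ((ν + μ + 1) / 2) ((ν + μ + 1 + 1) / 2) (ν + 3 / 2) (4 * p / (1 + p) ^ 2) * e

theorem ker_real (x1 x2 t : ℝ) :
    let p1 := Real.exp (-2 * x1); let p2 := Real.exp (-2 * x2); let y := Real.exp (-t)
    (Real.cosh x1 ^ 2 + Real.cosh x2 ^ 2 + Real.cosh (x1 + x2 + t) ^ 2 - 1) /
      (2 * Real.cosh x1 * Real.cosh x2) - Real.cosh (x1 + x2 + t) =
    Real.exp (2 * (x1 + x2 + t)) * ((1 - y) * ((1 - p1 * p2 * y) * (1 - p1 * y) * (1 - p2 * y))) /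
      (8 * (Real.cosh x1 * Real.cosh x2)) := by
  intro p1 p2 y
  have h1 := Real.cosh_pos x1
  have h2 := Real.cosh_pos x2
  rw [div_sub' (by positivity), div_eq_div_iff (by positivity) (by positivity)]
  have key : 4 * (Real.cosh x1 ^ 2 + Real.cosh x2 ^ 2 + Real.cosh (x1 + x2 + t) ^ 2 - 1
      - 2 * Real.cosh x1 * Real.cosh x2 * Real.cosh (x1 + x2 + t)) =
      Real.exp (2 * (x1 + x2 + t)) * ((1 - y) * ((1 - p1 * p2 * y) * (1 - p1 * y) * (1 - p2 * y))) := by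
    have a1 : p1 = (Real.exp x1)⁻¹ ^ 2 := by
      rw [← Real.exp_neg, ← Real.exp_nat_mul]; simp only [p1]; congr 1; push_cast; ring
    have a2 : p2 = (Real.exp x2)⁻¹ ^ 2 := by
      rw [← Real.exp_neg, ← Real.exp_nat_mul]; simp only [p2]; congr 1; push_cast; ring
    have a3 : y = (Real.exp t)⁻¹ := by rw [← Real.exp_neg]
    have a4 : Real.exp (2 * (x1 + x2 + t)) = (Real.exp x1 * Real.exp x2 * Real.exp t) ^ 2 := by
      rw [← Real.exp_add, ← Real.exp_add, ← Real.exp_nat_mul]; norm_num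
    rw [a1, a2, a3, a4, Real.cosh_eq, Real.cosh_eq, Real.cosh_eq, Real.exp_neg, Real.exp_neg, Real.exp_neg,
      Real.exp_add, Real.exp_add]
    have b1 := (Real.exp_pos x1).ne'
    have b2 := (Real.exp_pos x2).ne'
    have b3 := (Real.exp_pos t).ne'
    generalize Real.exp x1 = u at *
    generalize Real.exp x2 = v at *
    generalize Real.exp t = w at *
    field_simp
    ring
  linear_combination (2 * Real.cosh x1 * Real.cosh x2) * key

open MeasureTheory Set Filter Topology

theorem pull_pt (ν μ : ℂ) {x1 x2 : ℝ} (h1 : 0 < x1) (h2 : 0 < x2) (s : ℝ) (hs : 0 < s)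
    (F : ℝ → ℂ)
    (hF : ∀ z₃, F z₃ = legendreQ ν μ z₃ *
        (((Real.cosh x1 ^ 2 + Real.cosh x2 ^ 2 + z₃ ^ 2 - 1) / (2 * Real.cosh x1 * Real.cosh x2) - z₃ : ℝ) : ℂ) ^ (μ - 1 / 2) *
        ((z₃ ^ 2 - 1 : ℝ) : ℂ) ^ (-μ / 2)) :
    |Real.sinh (x1 + x2 + s)| • F (Real.cosh (x1 + x2 + s)) =
      ((Real.sqrt Real.pi : ℂ) * Complex.exp ((Real.pi : ℂ) * Complex.I * μ) *
      Complex.Gamma (ν + μ + 1) * (Complex.exp ((1 / 2 - 2 * μ) * (Real.log 2 : ℝ)) *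
      Complex.exp (-(ν - μ + 1) * (x1 + x2 : ℝ)) *
      Complex.exp (-(μ - 1 / 2) * (Real.log (Real.cosh x1 * Real.cosh x2) : ℝ)))) *
      (qK μ (ν - μ) s * qA μ (ν - μ) (Real.exp (-2 * x1)) (Real.exp (-2 * x2)) (Real.exp (-s))) := by
  have hk := ker_real x1 x2 s
  simp only at hk
  have ht : 0 < x1 + x2 + s := by positivity
  obtain ⟨t, htd⟩ : ∃ t, t = x1 + x2 + s := ⟨_, rfl⟩
  have c1 := Real.cosh_pos x1
  have c2 := Real.cosh_pos x2
  obtain ⟨Z, hZ⟩ : ∃ Z, Z = Real.cosh x1 * Real.cosh x2 := ⟨_, rfl⟩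
  have hZ0 : 0 < Z := by rw [hZ]; positivity
  obtain ⟨p1, hp1⟩ : ∃ p, p = Real.exp (-2 * x1) := ⟨_, rfl⟩
  obtain ⟨p2, hp2⟩ : ∃ p, p = Real.exp (-2 * x2) := ⟨_, rfl⟩
  obtain ⟨y, hy⟩ : ∃ p, p = Real.exp (-s) := ⟨_, rfl⟩
  have q1 : 0 < p1 := by rw [hp1]; positivity
  have q1' : p1 < 1 := by rw [hp1, Real.exp_lt_one_iff]; linarith
  have q2 : 0 < p2 := by rw [hp2]; positivity
  have q2' : p2 < 1 := by rw [hp2, Real.exp_lt_one_iff]; linarith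
  have q3 : 0 < y := by rw [hy]; positivity
  have q3' : y < 1 := by rw [hy, Real.exp_lt_one_iff]; linarith
  have hy1 : 0 < 1 - y := by linarith
  have hB : 0 < (1 - p1 * p2 * y) * (1 - p1 * y) * (1 - p2 * y) := by
    have a : p1 * y < 1 := by nlinarith
    have b : p2 * y < 1 := by nlinarith
    have c : p1 * p2 * y < 1 := by nlinarith
    have := sub_pos.2 a
    have := sub_pos.2 b
    have := sub_pos.2 c
    positivity
  have hp3 : Real.exp (-2 * t) = p1 * p2 * y ^ 2 := by
    rw [hp1, hp2, hy, ← Real.exp_nat_mul, ← Real.exp_add, ← Real.exp_add, htd]; congr 1; push_cast; ring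
  have hsinh : Real.sinh t = Real.exp t * (1 - p1 * p2 * y ^ 2) / 2 := by
    rw [← hp3, Real.sinh_eq, mul_sub, ← Real.exp_add]; congr 2
    · ring
    · congr 1; ring
  have hs0 : 0 < Real.sinh t := Real.sinh_pos_iff.2 (htd ▸ ht)
  have hS : 0 < Real.cosh t ^ 2 - 1 := by rw [Real.cosh_sq]; nlinarith
  rw [hF, hk, ← htd, ← hp1, ← hp2, ← hy, ← hZ, abs_of_pos hs0, Complex.real_smul,
    legQ_cosh ν μ (htd ▸ ht), hp3, qK, qA, ← hy]
  generalize hBd : (1 - p1 * p2 * y) * (1 - p1 * y) * (1 - p2 * y) = B at *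
  generalize Real.cosh t ^ 2 - 1 = S at *
  have hlog : Real.log (Real.exp (2 * t) * ((1 - y) * B) / (8 * Z)) =
      2 * t + Real.log (1 - y) + Real.log B - 3 * Real.log 2 - Real.log Z := by
    rw [Real.log_div (by positivity) (by positivity), Real.log_mul (by positivity) (by positivity),
      Real.log_mul (by positivity) (by positivity), Real.log_mul (by positivity) (by positivity), Real.log_exp,
      show (8:ℝ) = 2 ^ 3 by norm_num, Real.log_pow]
    push_cast; ring
  have hK : 0 < Real.exp (2 * t) * ((1 - y) * B) / (8 * Z) := by positivity
  rw [cpow_pos hK, hlog, cpow_pos hS, cpow_pos hS, cpow_pos hy1, cpow_pos hB, hsinh]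
  have hhalf : (((Real.exp t * (1 - p1 * p2 * y ^ 2) / 2 : ℝ)) : ℂ) =
      Complex.exp (t - (Real.log 2 : ℝ)) * ((1 - p1 * p2 * y ^ 2 : ℝ) : ℂ) := by
    have : Real.exp t * (1 - p1 * p2 * y ^ 2) / 2 = Real.exp (t - Real.log 2) * (1 - p1 * p2 * y ^ 2) := by
      rw [Real.exp_sub, Real.exp_log (by norm_num)]; ring
    rw [this, Complex.ofReal_mul, Complex.ofReal_exp, Complex.ofReal_sub]
  rw [hhalf]
  generalize ((1 - p1 * p2 * y ^ 2 : ℝ) : ℂ) = W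
  generalize qPhi μ (ν - μ) (p1 * p2 * y ^ 2) = Φ
  have e : Complex.exp (t - (Real.log 2 : ℝ)) * (Complex.exp (μ / 2 * (Real.log S : ℝ)) *
      (Complex.exp (μ * (Real.log 2 : ℝ)) * Complex.exp (-(ν + μ + 1) * t))) *
      Complex.exp ((μ - 1 / 2) * ((2 * t + Real.log (1 - y) + Real.log B - 3 * Real.log 2 - Real.log Z : ℝ) : ℂ)) *
      Complex.exp (-μ / 2 * (Real.log S : ℝ)) =
      Complex.exp ((1 / 2 - 2 * μ) * (Real.log 2 : ℝ)) *
      Complex.exp (-(ν - μ + 1) * (x1 + x2 : ℝ)) *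
      Complex.exp (-(μ - 1 / 2) * (Real.log Z : ℝ)) *
      (Complex.exp (-(ν - μ + 1) * s) * Complex.exp ((μ - 1 / 2) * (Real.log (1 - y) : ℝ)) *
        Complex.exp ((μ - 1 / 2) * (Real.log B : ℝ))) := by
    simp only [← Complex.exp_add]
    congr 1; rw [htd]; push_cast; ring
  linear_combination (Real.sqrt Real.pi : ℂ) * Complex.exp ((Real.pi : ℂ) * Complex.I * μ) *
      Complex.Gamma (ν + μ + 1) * W * Φ * e

theorem cosh_image {w : ℝ} (hw : 0 < w) :
    (fun s => Real.cosh (w + s)) '' Ioi 0 = Ioi (Real.cosh w) := by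
  ext z
  constructor
  · rintro ⟨s, hs, rfl⟩
    have hs : 0 < s := hs
    simp only [mem_Ioi]
    rw [Real.cosh_lt_cosh, abs_of_pos hw, abs_of_pos (by linarith)]
    linarith
  · intro hz
    have hz : Real.cosh w < z := hz
    have h1 : 1 ≤ z := le_trans (Real.one_le_cosh w) hz.le
    refine ⟨Real.arcosh z - w, ?_, ?_⟩
    · have : Real.cosh w < Real.cosh (Real.arcosh z) := by rwa [Real.cosh_arcosh h1]
      rw [Real.cosh_lt_cosh, abs_of_pos hw, abs_of_nonneg (Real.arcosh_nonneg h1)] at this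
      exact sub_pos.2 this
    · simp [Real.cosh_arcosh h1]

theorem main_cosh (ν μ : ℂ) (hνμ : -1 < (ν - μ).re) (h : ∀ n : ℕ, ν + μ + 1 ≠ -(n : ℂ))
    {x1 x2 : ℝ} (h1 : 0 < x1) (h2 : 0 < x2)
    (F : ℝ → ℂ)
    (hF : ∀ z₃, F z₃ = legendreQ ν μ z₃ *
        (((Real.cosh x1 ^ 2 + Real.cosh x2 ^ 2 + z₃ ^ 2 - 1) / (2 * Real.cosh x1 * Real.cosh x2) - z₃ : ℝ) : ℂ) ^ (μ - 1 / 2) *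
        ((z₃ ^ 2 - 1 : ℝ) : ℂ) ^ (-μ / 2))
    (hint : IntegrableOn F (Ioi (Real.cosh (x1 + x2)))) :
    legendreQ ν μ (Real.cosh x1) * legendreQ ν μ (Real.cosh x2) =
      Complex.exp ((Real.pi : ℂ) * Complex.I * μ) * (Real.sqrt (Real.pi / 2) : ℂ) *
          Complex.Gamma (ν + μ + 1) / (Complex.Gamma (μ + 1 / 2) * Complex.Gamma (ν - μ + 1)) *
        (((Real.cosh x1 * Real.cosh x2 : ℝ) : ℂ) ^ (μ - 1 / 2) /
          (((Real.cosh x1 ^ 2 - 1 : ℝ) : ℂ) ^ (μ / 2) * ((Real.cosh x2 ^ 2 - 1 : ℝ) : ℂ) ^ (μ / 2))) *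
        ∫ z₃ in Ioi (Real.cosh (x1 + x2)), F z₃ := by
  have hw : 0 < x1 + x2 := by positivity
  have hder : ∀ s ∈ Ioi (0:ℝ), HasDerivWithinAt (fun s => Real.cosh (x1 + x2 + s))
      (Real.sinh (x1 + x2 + s)) (Ioi 0) s := by
    intro s hs
    have := (Real.hasDerivAt_cosh (x1 + x2 + s)).comp s ((hasDerivAt_id s).const_add (x1 + x2))
    simp only [mul_one] at this
    exact this.hasDerivWithinAt
  have hinj : InjOn (fun s => Real.cosh (x1 + x2 + s)) (Ioi 0) := by
    intro a ha b hb hab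
    have ha : 0 < a := ha
    have hb : 0 < b := hb
    have := Real.cosh_injOn (Set.mem_Ici.2 (by linarith : 0 ≤ x1 + x2 + a))
      (Set.mem_Ici.2 (by linarith : 0 ≤ x1 + x2 + b)) hab
    linarith
  obtain ⟨C, hC⟩ : ∃ C, C = ((Real.sqrt Real.pi : ℂ) * Complex.exp ((Real.pi : ℂ) * Complex.I * μ) *
      Complex.Gamma (ν + μ + 1) * (Complex.exp ((1 / 2 - 2 * μ) * (Real.log 2 : ℝ)) *
      Complex.exp (-(ν - μ + 1) * (x1 + x2 : ℝ)) *
      Complex.exp (-(μ - 1 / 2) * (Real.log (Real.cosh x1 * Real.cosh x2) : ℝ)))) := ⟨_, rfl⟩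
  have hG : Complex.Gamma (ν + μ + 1) ≠ 0 := Complex.Gamma_ne_zero h
  have hC0 : C ≠ 0 := by
    have : (Real.sqrt Real.pi : ℂ) ≠ 0 := by exact_mod_cast (Real.sqrt_pos.2 Real.pi_pos).ne'
    rw [hC]
    simp only [ne_eq, mul_eq_zero, Complex.exp_ne_zero, hG, this, or_self, not_false_eq_true]
  have hpt : ∀ s ∈ Ioi (0:ℝ), |Real.sinh (x1 + x2 + s)| • F (Real.cosh (x1 + x2 + s)) =
      C * (qK μ (ν - μ) s * qA μ (ν - μ) (Real.exp (-2 * x1)) (Real.exp (-2 * x2)) (Real.exp (-s))) := by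
    intro s hs
    rw [hC]; exact pull_pt ν μ h1 h2 s hs F hF
  rw [← cosh_image hw] at hint ⊢
  rw [integrableOn_image_iff_integrableOn_abs_deriv_smul measurableSet_Ioi hder hinj] at hint
  rw [integral_image_eq_integral_abs_deriv_smul measurableSet_Ioi hder hinj]
  rw [integrableOn_congr_fun hpt measurableSet_Ioi] at hint
  rw [setIntegral_congr_fun measurableSet_Ioi hpt, integral_const_mul]
  have hi : IntegrableOn (fun s => qK μ (ν - μ) s *
      qA μ (ν - μ) (Real.exp (-2 * x1)) (Real.exp (-2 * x2)) (Real.exp (-s))) (Ioi 0) := by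
    have := hint.const_mul C⁻¹
    simpa [inv_mul_cancel_left₀ hC0, IntegrableOn] using this
  obtain ⟨p1, hp1⟩ : ∃ p, p = Real.exp (-2 * x1) := ⟨_, rfl⟩
  obtain ⟨p2, hp2⟩ : ∃ p, p = Real.exp (-2 * x2) := ⟨_, rfl⟩
  have q1 : 0 < p1 := by rw [hp1]; positivity
  have q1' : p1 < 1 := by rw [hp1, Real.exp_lt_one_iff]; linarith
  have q2 : 0 < p2 := by rw [hp2]; positivity
  have q2' : p2 < 1 := by rw [hp2, Real.exp_lt_one_iff]; linarith
  rw [← hp1, ← hp2] at hi ⊢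
  have key := qE_all μ (ν - μ) hνμ q1 q1' q2 q2' hi
  generalize ∫ s in Ioi (0:ℝ), qK μ (ν - μ) s * qA μ (ν - μ) p1 p2 (Real.exp (-s)) = J at *
  have hS : ∀ x p : ℝ, 0 < x → p = Real.exp (-2 * x) → 0 < Real.cosh x ^ 2 - 1 ∧
      Real.log (Real.cosh x ^ 2 - 1) = 2 * x + 2 * Real.log (1 - p) - 2 * Real.log 2 := by
    intro x p hx hp
    have hp' : 0 < 1 - p := by
      rw [sub_pos, hp, Real.exp_lt_one_iff]; linarith
    have e : Real.cosh x ^ 2 - 1 = (Real.exp x * (1 - p) / 2) ^ 2 := by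
      rw [Real.cosh_sq, add_sub_cancel_right, Real.sinh_eq, mul_sub, hp, ← Real.exp_add]
      congr 2; rw [mul_one]; congr 2; ring
    rw [e]
    refine ⟨by positivity, ?_⟩
    rw [Real.log_pow, Real.log_div (by positivity) (by norm_num), Real.log_mul (by positivity) hp'.ne',
      Real.log_exp]
    push_cast; ring
  obtain ⟨s1, l1⟩ := hS x1 p1 h1 hp1
  obtain ⟨s2, l2⟩ := hS x2 p2 h2 hp2
  rw [legQ_cosh ν μ h1, legQ_cosh ν μ h2, ← hp1, ← hp2, hC]
  have c1 := Real.cosh_pos x1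
  have c2 := Real.cosh_pos x2
  rw [cpow_pos s1, cpow_pos s2, l1, l2, cpow_pos (mul_pos c1 c2)]
  rw [cpow_pos (sub_pos.2 q1'), cpow_pos (sub_pos.2 q2')] at key
  have hpi : (Real.sqrt (Real.pi / 2) : ℂ) * Complex.exp ((1 / 2) * (Real.log 2 : ℝ)) = (Real.sqrt Real.pi : ℂ) := by
    have : Real.sqrt 2 = Real.exp ((1 / 2) * Real.log 2) := by
      rw [Real.sqrt_eq_rpow, Real.rpow_def_of_pos (by norm_num), mul_comm]
    have e2 : Real.sqrt (Real.pi / 2) * Real.exp ((1 / 2) * Real.log 2) = Real.sqrt Real.pi := by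
      rw [← this, ← Real.sqrt_mul (by positivity)]; congr 1; ring
    rw [← e2]; push_cast; rfl
  rw [show Complex.exp ((1 / 2 - 2 * μ) * (Real.log 2 : ℝ)) =
    Complex.exp ((1 / 2) * (Real.log 2 : ℝ)) * Complex.exp (-2 * μ * (Real.log 2 : ℝ)) by
      rw [← Complex.exp_add]; congr 1; ring]
  generalize (Complex.Gamma (μ + 1 / 2) * Complex.Gamma (ν - μ + 1)) = D at *
  generalize qPhi μ (ν - μ) p1 = Φ1 at *
  generalize qPhi μ (ν - μ) p2 = Φ2 at *
  rw [div_eq_mul_inv _ D, div_eq_mul_inv (Complex.exp _), mul_inv (Complex.exp _), ← Complex.exp_neg, ← Complex.exp_neg]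
  generalize Real.log (Real.cosh x1 * Real.cosh x2) = lZ
  generalize Real.log (1 - p1) = a1 at *
  generalize Real.log (1 - p2) = a2 at *
  generalize Real.log 2 = l at *
  have e : Complex.exp ((μ - 1 / 2) * lZ) * (Complex.exp (-(μ / 2 * ((2 * x1 + 2 * a1 - 2 * l : ℝ) : ℂ))) *
      Complex.exp (-(μ / 2 * ((2 * x2 + 2 * a2 - 2 * l : ℝ) : ℂ)))) *
      (Complex.exp (-2 * μ * l) * Complex.exp (-(ν - μ + 1) * (x1 + x2 : ℝ)) * Complex.exp (-(μ - 1 / 2) * lZ)) *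
      (Complex.exp (2 * μ * a1) * Complex.exp (2 * μ * a2)) =
      Complex.exp (μ / 2 * ((2 * x1 + 2 * a1 - 2 * l : ℝ) : ℂ)) *
      (Complex.exp (μ * l) * Complex.exp (-(ν + μ + 1) * x1)) *
      (Complex.exp (μ / 2 * ((2 * x2 + 2 * a2 - 2 * l : ℝ) : ℂ)) *
      (Complex.exp (μ * l) * Complex.exp (-(ν + μ + 1) * x2))) := by
    simp only [← Complex.exp_add]
    congr 1; push_cast; ring
  generalize hA : Complex.exp ((μ - 1 / 2) * lZ) * (Complex.exp (-(μ / 2 * ((2 * x1 + 2 * a1 - 2 * l : ℝ) : ℂ))) *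
      Complex.exp (-(μ / 2 * ((2 * x2 + 2 * a2 - 2 * l : ℝ) : ℂ)))) = A at *
  generalize Complex.exp (1 / 2 * (l:ℂ)) = r at *
  rw [← hpi]
  generalize Complex.exp ((Real.pi : ℂ) * Complex.I * μ) = E
  generalize (Real.sqrt (Real.pi / 2) : ℂ) = R at *
  generalize Complex.Gamma (ν + μ + 1) = g
  linear_combination (-(R * r * E * g) * (R * r * E * g) * Φ1 * Φ2) * e +
    (E * R * g * A * (R * r * E * g * (r * Complex.exp (-2 * μ * l) * Complex.exp (-(ν - μ + 1) * (x1 + x2 : ℝ)) * Complex.exp (-(μ - 1 / 2) * lZ)))) * key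

/-- Integral representation for a product of two associated Legendre
functions of the second kind. -/
theorem legendreQQ_kernel_product
    (ν μ : ℂ) (hνμ : -1 < (ν - μ).re) (h : ∀ n : ℕ, ν + μ + 1 ≠ -(n : ℂ))
    (z₁ z₂ : ℝ) (hz₁ : 1 < z₁) (hz₂ : 1 < z₂)
    (F : ℝ → ℂ)
    (hF : ∀ z₃, F z₃ = legendreQ ν μ z₃ *
        (((z₁ ^ 2 + z₂ ^ 2 + z₃ ^ 2 - 1) / (2 * z₁ * z₂) - z₃ : ℝ) : ℂ) ^ (μ - 1 / 2) *
        ((z₃ ^ 2 - 1 : ℝ) : ℂ) ^ (-μ / 2))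
    (hint : IntegrableOn F (Ioi (z₁ * z₂ + Real.sqrt ((z₁ ^ 2 - 1) * (z₂ ^ 2 - 1))))) :
    legendreQ ν μ z₁ * legendreQ ν μ z₂ =
      Complex.exp ((Real.pi : ℂ) * Complex.I * μ) * (Real.sqrt (Real.pi / 2) : ℂ) *
          Complex.Gamma (ν + μ + 1) / (Complex.Gamma (μ + 1 / 2) * Complex.Gamma (ν - μ + 1)) *
        (((z₁ * z₂ : ℝ) : ℂ) ^ (μ - 1 / 2) /
          (((z₁ ^ 2 - 1 : ℝ) : ℂ) ^ (μ / 2) * ((z₂ ^ 2 - 1 : ℝ) : ℂ) ^ (μ / 2))) *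
        ∫ z₃ in Ioi (z₁ * z₂ + Real.sqrt ((z₁ ^ 2 - 1) * (z₂ ^ 2 - 1))), F z₃ := by
  obtain ⟨x1, h1, rfl⟩ : ∃ x, 0 < x ∧ Real.cosh x = z₁ :=
    ⟨Real.arcosh z₁, Real.arcosh_pos hz₁, Real.cosh_arcosh hz₁.le⟩
  obtain ⟨x2, h2, rfl⟩ : ∃ x, 0 < x ∧ Real.cosh x = z₂ :=
    ⟨Real.arcosh z₂, Real.arcosh_pos hz₂, Real.cosh_arcosh hz₂.le⟩
  have hw : Real.cosh x1 * Real.cosh x2 +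
      Real.sqrt ((Real.cosh x1 ^ 2 - 1) * (Real.cosh x2 ^ 2 - 1)) = Real.cosh (x1 + x2) := by
    have e : (Real.cosh x1 ^ 2 - 1) * (Real.cosh x2 ^ 2 - 1) = (Real.sinh x1 * Real.sinh x2) ^ 2 := by
      rw [Real.cosh_sq, Real.cosh_sq]; ring
    have s1 := Real.sinh_pos_iff.2 h1
    have s2 := Real.sinh_pos_iff.2 h2
    rw [e, Real.sqrt_sq (by positivity), Real.cosh_add]
  rw [hw] at hint ⊢
  exact main_cosh ν μ hνμ h h1 h2 F hF hint
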